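/- Assume the anti-concentration hypothesis: c̄ > 0, η > 0, k is a positive even integer, and the inlier matrices {A_i}_{i∈I} are k-certifiably (α²·η²·(1−2c̄)²/(32·c̄), 2c̄, 2M_x)-anti-concentrated. Fix ℓ ≥ k and let μ̃ be a level-ℓ pseudo-distribution in the variables (ω, x) satisfying T_{ω,x} at degree 0 such that ‖Ẽ_μ̃[ω]‖ ≤ ‖Ẽ_ν[ω]‖ for every level-ℓ pseudo-distribution ν satisfying T_{ω,x} at degree 0 (where Ẽ[ω] ∈ ℝⁿ denotes the vector with entries Ẽ[ω_i]). Then ∑_{i ∈ S} Ẽ_μ̃[ω_i] ≥ α²·n/2, where S := {i ∈ {1,…,n} : ‖v_i − x°‖ ≤ η·M_x}; equivalently, if an index i is drawn at random with probability Ẽ_μ̃[ω_i]/(αn), then ‖v_i − x°‖ ≤ η·M_x holds with probability at least α/2. -/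

import Mathlib

open scoped BigOperators
open MvPolynomial

noncomputable section

/-- A polynomial is a sum of squares. -/
def IsSOS {V : Type*} (p : MvPolynomial V ℝ) : Prop :=
  ∃ (N : ℕ) (q : Fin N → MvPolynomial V ℝ), p = ∑ j, q j ^ 2

/-- A degree-`k` sum-of-squares proof that the system `{A i ≥ 0}` implies `g ≥ 0`:
a family of sos polynomials `P S`, indexed by the subsets `S` of the constraint
indices, with `g = ∑_S P S · ∏_{i∈S} A i` and every summand of degree at most `k`. -/
def SosProof {V ι : Type*} [Fintype ι] [DecidableEq ι]
    (A : ι → MvPolynomial V ℝ) (k : ℕ) (g : MvPolynomial V ℝ) : Prop :=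
  ∃ P : Finset ι → MvPolynomial V ℝ,
    (∀ S, IsSOS (P S)) ∧
    g = ∑ S : Finset ι, P S * ∏ i ∈ S, A i ∧
    ∀ S : Finset ι, (P S * ∏ i ∈ S, A i).totalDegree ≤ k

/-- Pseudo-expectation of `f` under the finitely supported `μ`. -/
def pExpect {V : Type*} (μ : (V → ℝ) →₀ ℝ) (f : (V → ℝ) → ℝ) : ℝ :=
  ∑ z ∈ μ.support, μ z * f z

/-- `μ` is a pseudo-distribution of level `ℓ`: finitely supported, total mass one,
and nonnegative pseudo-expectation on every square of a polynomial of degree `≤ ℓ/2`. -/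
def IsPseudoDist {V : Type*} (μ : (V → ℝ) →₀ ℝ) (ℓ : ℕ) : Prop :=
  (∑ z ∈ μ.support, μ z) = 1 ∧
  ∀ p : MvPolynomial V ℝ, p.totalDegree ≤ ℓ / 2 →
    0 ≤ pExpect μ fun z => MvPolynomial.eval z p ^ 2

/-- A level-`ℓ` pseudo-distribution `μ` satisfies the system `{A i ≥ 0}` at degree `k`. -/
def PDSatisfies {V ι : Type*} [Fintype ι] [DecidableEq ι]
    (μ : (V → ℝ) →₀ ℝ) (ℓ : ℕ) (A : ι → MvPolynomial V ℝ) (k : ℕ) : Prop :=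
  ∀ (S : Finset ι) (h : MvPolynomial V ℝ), IsSOS h →
    h.totalDegree + ∑ i ∈ S, max (A i).totalDegree k ≤ ℓ →
    0 ≤ pExpect μ fun z => MvPolynomial.eval z (h * ∏ i ∈ S, A i)

/-- Euclidean norm of a finite real vector. -/
def enorm {d : ℕ} (v : Fin d → ℝ) : ℝ := Real.sqrt (∑ k, v k ^ 2)

/-- The polynomial `‖A_iᵀ v‖²` in the indeterminate `v ∈ ℝ^{dx}`. -/
def normAPoly {n dx dy : ℕ} (A : Fin n → Matrix (Fin dx) (Fin dy) ℝ) (i : Fin n) :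
    MvPolynomial (Fin dx) ℝ :=
  ∑ j, (∑ k, C (A i k j) * X k) ^ 2

/-- The polynomial `‖v‖²` in the indeterminate `v ∈ ℝ^{dx}`. -/
def vnormPoly (dx : ℕ) : MvPolynomial (Fin dx) ℝ :=
  ∑ k, (X k : MvPolynomial (Fin dx) ℝ) ^ 2

/-- The matrices `{A_i}_{i∈I}` are `k`-certifiably `(Cc, δ, M)`-anti-concentrated:
there is an even univariate polynomial `p` with `p 0 = 1` (evenness witnessed by
`q` with `p(t) = q(t²)`) such that the two anti-concentration inequalities admit
degree-`k` sum-of-squares proofs; `p(‖A_iᵀ v‖)² = q(‖A_iᵀ v‖²)²` as a polynomial in `v`. -/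
def AntiConcentrated {n dx dy : ℕ} (A : Fin n → Matrix (Fin dx) (Fin dy) ℝ)
    (I : Finset (Fin n)) (k : ℕ) (Cc δ M : ℝ) : Prop :=
  ∃ p q : Polynomial ℝ,
    (∀ t : ℝ, p.eval t = q.eval (t ^ 2)) ∧ p.eval 0 = 1 ∧
    (∀ i ∈ I,
      SosProof (fun _ : Fin 1 => C (δ ^ 2) - normAPoly A i) k
        (Polynomial.aeval (normAPoly A i) q ^ 2 - C ((1 - δ) ^ 2))) ∧
    SosProof (fun _ : Fin 1 => C (M ^ 2) - vnormPoly dx) k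
      (C (Cc * δ * M ^ 2) -
        vnormPoly dx *
          (C ((I.card : ℝ)⁻¹) * ∑ i ∈ I, Polynomial.aeval (normAPoly A i) q ^ 2))

/-- The polynomial `‖y_i − A_iᵀ x‖²` in the variables `(ω, x)`. -/
def residPoly {n dx dy : ℕ} (y : Fin n → Fin dy → ℝ)
    (A : Fin n → Matrix (Fin dx) (Fin dy) ℝ) (i : Fin n) :
    MvPolynomial (Fin n ⊕ Fin dx) ℝ :=
  ∑ j, (C (y i j) - ∑ k, C (A i k j) * X (Sum.inr k)) ^ 2

/-- The system `M_{ω,x}`: `ω_i² = ω_i` (two inequalities each),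
`c̄² − ω_i·‖y_i − A_iᵀ x‖² ≥ 0`, and the inequalities `g_j(x) ≥ 0` describing `𝕏`. -/
def sysM {n dx dy mX : ℕ} (y : Fin n → Fin dy → ℝ)
    (A : Fin n → Matrix (Fin dx) (Fin dy) ℝ)
    (g : Fin mX → MvPolynomial (Fin dx) ℝ) (cbar : ℝ) :
    Fin n ⊕ Fin n ⊕ Fin n ⊕ Fin mX → MvPolynomial (Fin n ⊕ Fin dx) ℝ
  | Sum.inl i => X (Sum.inl i) - X (Sum.inl i) ^ 2
  | Sum.inr (Sum.inl i) => X (Sum.inl i) ^ 2 - X (Sum.inl i)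
  | Sum.inr (Sum.inr (Sum.inl i)) => C (cbar ^ 2) - X (Sum.inl i) * residPoly y A i
  | Sum.inr (Sum.inr (Sum.inr j)) => rename Sum.inr (g j)

/-- The system `T_{ω,x}`: `M_{ω,x}` together with `∑ ω_i = αn` (two inequalities). -/
def sysT {n dx dy mX : ℕ} (y : Fin n → Fin dy → ℝ)
    (A : Fin n → Matrix (Fin dx) (Fin dy) ℝ)
    (g : Fin mX → MvPolynomial (Fin dx) ℝ) (cbar α : ℝ) :
    Fin 2 ⊕ (Fin n ⊕ Fin n ⊕ Fin n ⊕ Fin mX) → MvPolynomial (Fin n ⊕ Fin dx) ℝ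
  | Sum.inl j =>
      if j = 0 then C (α * n) - ∑ i, X (Sum.inl i)
      else (∑ i, (X (Sum.inl i) : MvPolynomial (Fin n ⊕ Fin dx) ℝ)) - C (α * n)
  | Sum.inr e => sysM y A g cbar e

/-- The pseudo-expectation `Ẽ_μ[ω_i]`. -/
def Eω {n dx : ℕ} (μ : (Fin n ⊕ Fin dx → ℝ) →₀ ℝ) (i : Fin n) : ℝ :=
  pExpect μ fun z => z (Sum.inl i)

/-- The vector `v_i := Ẽ_μ[ω_i·x] / Ẽ_μ[ω_i]` if `Ẽ_μ[ω_i] > 0`, else `0`. -/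
def vEst {n dx : ℕ} (μ : (Fin n ⊕ Fin dx → ℝ) →₀ ℝ) (i : Fin n) : Fin dx → ℝ :=
  if 0 < Eω μ i then
    fun k => (Eω μ i)⁻¹ * pExpect μ fun z => z (Sum.inl i) * z (Sum.inr k)
  else 0

/-- The estimate `x̂ := ∑_i (Ẽ_μ[ω_i] / ∑_j Ẽ_μ[ω_j]) · v_i`. -/
def xhat {n dx : ℕ} (μ : (Fin n ⊕ Fin dx → ℝ) →₀ ℝ) : Fin dx → ℝ :=
  fun k => ∑ i, Eω μ i / (∑ j, Eω μ j) * vEst μ i k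

/-- A polynomial that is nonnegative on `[0, b]` except possibly at one point is
nonnegative on all of `[0, b]`. -/
lemma Polynomial.nonneg_of_nonneg_of_ne {b r : ℝ} (hb : 0 < b) (f : Polynomial ℝ)
    (h : ∀ t ∈ Set.Icc 0 b, t ≠ r → 0 ≤ f.eval t) : ∀ t ∈ Set.Icc 0 b, 0 ≤ f.eval t := by
  intro t ht
  by_cases htr : t = r
  · subst htr
    by_contra! hneg
    have hev : ∀ᶠ u in nhds t, f.eval u < 0 :=
      f.continuous.continuousAt.eventually (gt_mem_nhds hneg)
    obtain ⟨ε, hε, hball⟩ := Metric.eventually_nhds_iff.1 hev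
    by_cases htb : t < b
    · have h1 : t < min b (t + ε / 2) := lt_min htb (by linarith)
      have h2 := h (min b (t + ε / 2)) ⟨by linarith [ht.1], min_le_left _ _⟩ (by linarith)
      have h3 := hball (y := min b (t + ε / 2)) (by
        rw [Real.dist_eq, abs_lt]
        constructor <;> linarith [min_le_right b (t + ε / 2)])
      linarith
    · have htb' : t = b := le_antisymm ht.2 (not_lt.1 htb)
      have h1 : max 0 (t - ε / 2) < t := max_lt (by linarith) (by linarith)
      have h2 := h (max 0 (t - ε / 2)) ⟨le_max_left _ _, by linarith⟩ (by linarith)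
      have h3 := hball (y := max 0 (t - ε / 2)) (by
        rw [Real.dist_eq, abs_lt]
        constructor <;> linarith [le_max_right 0 (t - ε / 2)])
      linarith
  · exact h t ht htr

/-- `f` has a certificate of nonnegativity on `[0, b]` all of whose terms have degree at
most `d`. -/
def IntervalCone (b : ℝ) (d : ℕ) (f : Polynomial ℝ) : Prop :=
  ∃ σ₀ σ₁ σ₂ σ₃ : Polynomial ℝ, IsSumSq σ₀ ∧ IsSumSq σ₁ ∧ IsSumSq σ₂ ∧ IsSumSq σ₃ ∧
    σ₀.natDegree ≤ d ∧ (σ₁ = 0 ∨ σ₁.natDegree + 1 ≤ d) ∧ (σ₂ = 0 ∨ σ₂.natDegree + 1 ≤ d) ∧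
    (σ₃ = 0 ∨ σ₃.natDegree + 2 ≤ d) ∧
    f = σ₀ + Polynomial.X * σ₁ + (Polynomial.C b - Polynomial.X) * σ₂
      + Polynomial.X * (Polynomial.C b - Polynomial.X) * σ₃

namespace IntervalCone

variable {b : ℝ} {d e : ℕ} {f g : Polynomial ℝ}

lemma add_aux {σ τ : Polynomial ℝ} {j : ℕ} (hσ : σ = 0 ∨ σ.natDegree + j ≤ d)
    (hτ : τ = 0 ∨ τ.natDegree + j ≤ d) : σ + τ = 0 ∨ (σ + τ).natDegree + j ≤ d := by
  rcases hσ with rfl | hσ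
  · simpa using hτ
  rcases hτ with rfl | hτ
  · right; simpa using hσ
  · right
    have := Polynomial.natDegree_add_le σ τ
    rcases max_cases σ.natDegree τ.natDegree with h | h <;> omega

lemma mul_aux {σ τ : Polynomial ℝ} {j : ℕ} (hσ : σ = 0 ∨ σ.natDegree + j ≤ d)
    (hτ : τ.natDegree ≤ e) : τ * σ = 0 ∨ (τ * σ).natDegree + j ≤ d + e := by
  rcases hσ with rfl | hσ
  · simp
  · right
    have := Polynomial.natDegree_mul_le (p := τ) (q := σ)
    omega

lemma add (hf : IntervalCone b d f) (hg : IntervalCone b d g) : IntervalCone b d (f + g) := by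
  obtain ⟨σ₀, σ₁, σ₂, σ₃, h0, h1, h2, h3, d0, d1, d2, d3, rfl⟩ := hf
  obtain ⟨τ₀, τ₁, τ₂, τ₃, k0, k1, k2, k3, e0, e1, e2, e3, rfl⟩ := hg
  refine ⟨σ₀ + τ₀, σ₁ + τ₁, σ₂ + τ₂, σ₃ + τ₃, h0.add k0, h1.add k1, h2.add k2, h3.add k3,
    ?_, add_aux d1 e1, add_aux d2 e2, add_aux d3 e3, by ring⟩
  exact (Polynomial.natDegree_add_le _ _).trans (max_le d0 e0)

lemma sumSq_mul {Q : Polynomial ℝ} (hQ : IsSumSq Q) (hQe : Q.natDegree ≤ e)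
    (hf : IntervalCone b d f) : IntervalCone b (d + e) (Q * f) := by
  obtain ⟨σ₀, σ₁, σ₂, σ₃, h0, h1, h2, h3, d0, d1, d2, d3, rfl⟩ := hf
  refine ⟨Q * σ₀, Q * σ₁, Q * σ₂, Q * σ₃, hQ.mul h0, hQ.mul h1, hQ.mul h2, hQ.mul h3,
    ?_, mul_aux d1 hQe, mul_aux d2 hQe, mul_aux d3 hQe, by ring⟩
  have := Polynomial.natDegree_mul_le (p := Q) (q := σ₀)
  omega

lemma mono (hde : d ≤ e) (hf : IntervalCone b d f) : IntervalCone b e f := by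
  obtain ⟨σ₀, σ₁, σ₂, σ₃, h0, h1, h2, h3, d0, d1, d2, d3, rfl⟩ := hf
  exact ⟨σ₀, σ₁, σ₂, σ₃, h0, h1, h2, h3, d0.trans hde, d1.imp_right fun h => h.trans hde,
    d2.imp_right fun h => h.trans hde, d3.imp_right fun h => h.trans hde, rfl⟩

lemma isSumSq_C {r : ℝ} (hr : 0 ≤ r) : IsSumSq (Polynomial.C r) := by
  rw [← Real.mul_self_sqrt hr, Polynomial.C_mul]
  exact IsSumSq.mul_self _

lemma const_mul {r : ℝ} (hr : 0 ≤ r) (hf : IntervalCone b d f) :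
    IntervalCone b d (Polynomial.C r * f) := by
  simpa using hf.sumSq_mul (isSumSq_C hr) (e := 0) (by simp)

lemma const {r : ℝ} (hr : 0 ≤ r) : IntervalCone b 0 (Polynomial.C r) :=
  ⟨Polynomial.C r, 0, 0, 0, isSumSq_C hr, .zero, .zero, .zero, by simp, by simp, by simp,
    by simp, by simp⟩

lemma X_mul (hf : IntervalCone b d f) : IntervalCone b (d + 1) (Polynomial.X * f) := by
  obtain ⟨σ₀, σ₁, σ₂, σ₃, h0, h1, h2, h3, d0, d1, d2, d3, rfl⟩ := hf
  have hX : IsSumSq (Polynomial.X * Polynomial.X : Polynomial ℝ) := IsSumSq.mul_self _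
  have hXd : (Polynomial.X * Polynomial.X : Polynomial ℝ).natDegree ≤ 2 := by
    rw [← sq]; exact Polynomial.natDegree_X_pow_le 2
  refine ⟨Polynomial.X * Polynomial.X * σ₁, σ₀, Polynomial.X * Polynomial.X * σ₃, σ₂,
    hX.mul h1, h0, hX.mul h3, h2, ?_, Or.inr (by omega), ?_, ?_, by ring⟩
  · rcases mul_aux d1 hXd with h | h
    · simp [h]
    · omega
  · exact (mul_aux d3 hXd).imp_right fun h => by omega
  · exact d2.imp_right fun h => by omega

lemma sub_X_mul (hf : IntervalCone b d f) :
    IntervalCone b (d + 1) ((Polynomial.C b - Polynomial.X) * f) := by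
  obtain ⟨σ₀, σ₁, σ₂, σ₃, h0, h1, h2, h3, d0, d1, d2, d3, rfl⟩ := hf
  set Y : Polynomial ℝ := Polynomial.C b - Polynomial.X with hY
  have hX : IsSumSq (Y * Y) := IsSumSq.mul_self _
  have hY1 : Y.natDegree ≤ 1 :=
    (Polynomial.natDegree_sub_le _ _).trans (by simp)
  have hXd : (Y * Y).natDegree ≤ 2 := Polynomial.natDegree_mul_le.trans (by omega)
  refine ⟨Y * Y * σ₂, Y * Y * σ₃, σ₀, σ₁,
    hX.mul h2, hX.mul h3, h0, h1, ?_, ?_, Or.inr (by omega), ?_, by ring⟩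
  · rcases mul_aux d2 hXd with h | h
    · simp [h]
    · omega
  · exact (mul_aux d3 hXd).imp_right fun h => by omega
  · exact d1.imp_right fun h => by omega

/-- A polynomial nonnegative on `[0, b]` has a certificate of its own degree. -/
lemma of_nonneg (hb : 0 < b) (f : Polynomial ℝ) (hf : ∀ t ∈ Set.Icc 0 b, 0 ≤ f.eval t) :
    IntervalCone b f.natDegree f := by
  induction hd : f.natDegree using Nat.strong_induction_on generalizing f with
  | _ d ih =>
  subst hd
  by_cases hdeg : f.natDegree = 0
  · rw [Polynomial.eq_C_of_natDegree_eq_zero hdeg] at hf ⊢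
    have h0 := hf 0 ⟨le_rfl, hb.le⟩
    rw [Polynomial.eval_C] at h0
    simpa using const h0
  have hf0 : f ≠ 0 := by rintro rfl; simp at hdeg
  have hlin : ∀ (r : ℝ) (g : Polynomial ℝ), f = (Polynomial.X - Polynomial.C r) * g →
      f.natDegree = g.natDegree + 1 := by
    intro r g hg
    have hg0 : g ≠ 0 := by rintro rfl; simp [hf0] at hg
    rw [hg, Polynomial.natDegree_mul (Polynomial.X_sub_C_ne_zero r) hg0,
      Polynomial.natDegree_X_sub_C, add_comm]
  obtain ⟨z, hz⟩ := IsAlgClosed.exists_aeval_eq_zero ℂ f (by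
    intro h
    exact hdeg (Polynomial.natDegree_eq_zero_iff_degree_le_zero.2 h.le))
  by_cases him : z.im = 0
  · have hroot : f.IsRoot z.re := by
      have hzre : z = algebraMap ℝ ℂ z.re := by
        apply Complex.ext <;> simp [him]
      rw [hzre, Polynomial.aeval_algebraMap_apply] at hz
      simpa using hz
    generalize z.re = r at hroot
    obtain ⟨g, hg⟩ := Polynomial.dvd_iff_isRoot.2 hroot
    have hdg := hlin r g hg
    have hev : ∀ t, f.eval t = (t - r) * g.eval t := fun t => by rw [hg]; simp
    by_cases hr0 : r ≤ 0
    · have hgn : ∀ t ∈ Set.Icc 0 b, 0 ≤ g.eval t := by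
        apply Polynomial.nonneg_of_nonneg_of_ne (r := r) hb
        intro t ht htr
        have h1 := hf t ht
        rw [hev] at h1
        exact nonneg_of_mul_nonneg_right h1
          (lt_of_le_of_ne (by linarith [ht.1]) (sub_ne_zero.2 htr).symm)
      have hc := ih g.natDegree (by omega) g hgn rfl
      rw [hdg]
      convert hc.X_mul.add ((hc.const_mul (neg_nonneg.2 hr0)).mono (Nat.le_succ _)) using 1
      rw [hg, Polynomial.C_neg]; ring
    by_cases hrb : b ≤ r
    · have hgn : ∀ t ∈ Set.Icc 0 b, 0 ≤ (-g).eval t := by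
        apply Polynomial.nonneg_of_nonneg_of_ne (r := r) hb
        intro t ht htr
        have h1 := hf t ht
        rw [hev] at h1
        rw [Polynomial.eval_neg]
        have h2 : 0 < r - t := lt_of_le_of_ne (by linarith [ht.2]) (sub_ne_zero.2 htr.symm).symm
        exact nonneg_of_mul_nonneg_right (by linarith) h2
      have hc := ih (-g).natDegree (by rw [Polynomial.natDegree_neg]; omega) (-g) hgn rfl
      rw [Polynomial.natDegree_neg] at hc
      rw [hdg]
      convert hc.sub_X_mul.add
        ((hc.const_mul (sub_nonneg.2 hrb)).mono (Nat.le_succ _)) using 1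
      rw [hg, Polynomial.C_sub]; ring
    push Not at hr0 hrb
    have hgr : 0 ≤ g.eval r := by
      by_contra! hneg
      have hev' : ∀ᶠ u in nhds r, g.eval u < 0 :=
        g.continuous.continuousAt.eventually (gt_mem_nhds hneg)
      obtain ⟨ε, hε, hball⟩ := Metric.eventually_nhds_iff.1 hev'
      have h1 : r < min b (r + ε / 2) := lt_min hrb (by linarith)
      have h2 := hf (min b (r + ε / 2)) ⟨by linarith, min_le_left _ _⟩
      have h3 := hball (y := min b (r + ε / 2)) (by
        rw [Real.dist_eq, abs_lt]
        constructor <;> linarith [min_le_right b (r + ε / 2)])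
      rw [hev] at h2
      nlinarith
    have hgr' : g.eval r ≤ 0 := by
      by_contra! hneg
      have hev' : ∀ᶠ u in nhds r, 0 < g.eval u :=
        g.continuous.continuousAt.eventually (lt_mem_nhds hneg)
      obtain ⟨ε, hε, hball⟩ := Metric.eventually_nhds_iff.1 hev'
      have h1 : max 0 (r - ε / 2) < r := max_lt hr0 (by linarith)
      have h2 := hf (max 0 (r - ε / 2)) ⟨le_max_left _ _, by linarith⟩
      have h3 := hball (y := max 0 (r - ε / 2)) (by
        rw [Real.dist_eq, abs_lt]
        constructor <;> linarith [le_max_right 0 (r - ε / 2)])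
      rw [hev] at h2
      nlinarith
    obtain ⟨g2, hg2⟩ := Polynomial.dvd_iff_isRoot.2 (le_antisymm hgr' hgr : g.IsRoot r)
    have hg20 : g2 ≠ 0 := by
      rintro rfl
      rw [hg2] at hg
      simp [hf0] at hg
    have hdg2 : g.natDegree = g2.natDegree + 1 := by
      rw [hg2, Polynomial.natDegree_mul (Polynomial.X_sub_C_ne_zero r) hg20,
        Polynomial.natDegree_X_sub_C, add_comm]
    have hgn : ∀ t ∈ Set.Icc 0 b, 0 ≤ g2.eval t := by
      apply Polynomial.nonneg_of_nonneg_of_ne (r := r) hb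
      intro t ht htr
      have h1 := hf t ht
      rw [hev, hg2] at h1
      have h2 : 0 < (t - r) ^ 2 := by have := sub_ne_zero.2 htr; positivity
      apply nonneg_of_mul_nonneg_right (a := (t - r) ^ 2) _ h2
      simp at h1
      linarith
    have hc := ih g2.natDegree (by omega) g2 hgn rfl
    rw [hdg, hdg2]
    convert hc.sumSq_mul (Q := (Polynomial.X - Polynomial.C r) * (Polynomial.X - Polynomial.C r))
      (IsSumSq.mul_self _) (e := 2)
      (Polynomial.natDegree_mul_le.trans (by simp)) using 1
    rw [hg, hg2]; ring
  · obtain ⟨g, hg⟩ := Polynomial.quadratic_dvd_of_aeval_eq_zero_im_ne_zero f hz him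
    set Q : Polynomial ℝ := Polynomial.X ^ 2 - Polynomial.C (2 * z.re) * Polynomial.X
      + Polynomial.C (‖z‖ ^ 2) with hQ
    have hQeq : Q = (Polynomial.X - Polynomial.C z.re) * (Polynomial.X - Polynomial.C z.re)
        + Polynomial.C z.im * Polynomial.C z.im := by
      rw [hQ, Complex.sq_norm, Complex.normSq_apply]
      simp only [Polynomial.C_mul, Polynomial.C_add]
      rw [show Polynomial.C (2 : ℝ) = 2 from rfl]
      ring
    have hQ2 : Q.natDegree = 2 := by
      rw [hQ]; compute_degree!
    have hQ0 : Q ≠ 0 := by rintro h; rw [h] at hQ2; simp at hQ2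
    have hg0 : g ≠ 0 := by rintro rfl; simp [hf0] at hg
    have hdg : f.natDegree = g.natDegree + 2 := by
      rw [hg, Polynomial.natDegree_mul hQ0 hg0, hQ2, add_comm]
    have hgn : ∀ t ∈ Set.Icc 0 b, 0 ≤ g.eval t := by
      intro t ht
      have h1 := hf t ht
      rw [hg, Polynomial.eval_mul] at h1
      refine nonneg_of_mul_nonneg_right h1 ?_
      rw [hQeq]
      simp
      have : 0 < z.im * z.im := mul_self_pos.2 him
      nlinarith [mul_self_nonneg (t - z.re)]
    have hc := ih g.natDegree (by omega) g hgn rfl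
    rw [hdg, hg]
    refine hc.sumSq_mul ?_ hQ2.le
    rw [hQeq]
    exact (IsSumSq.mul_self _).add (IsSumSq.mul_self _)

end IntervalCone

section SosDeg

variable {V : Type*}

lemma isSOS_iff_isSumSq {p : MvPolynomial V ℝ} : IsSOS p ↔ IsSumSq p := by
  constructor
  · rintro ⟨N, q, rfl⟩
    exact IsSumSq.sum_sq _ _
  · intro h
    induction h with
    | zero => exact ⟨0, Fin.elim0, by simp⟩
    | sq_add a _ ih =>
      obtain ⟨N, q, rfl⟩ := ih
      exact ⟨N + 1, Fin.cons a q, by simp [Fin.sum_univ_succ, sq]⟩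

/-- `p` is a sum of squares of total degree at most `d`. -/
def SosDeg (d : ℕ) (p : MvPolynomial V ℝ) : Prop := IsSumSq p ∧ p.totalDegree ≤ d

namespace SosDeg

variable {d e : ℕ} {p q : MvPolynomial V ℝ}

lemma mono (hde : d ≤ e) (hp : SosDeg d p) : SosDeg e p := ⟨hp.1, hp.2.trans hde⟩

lemma mul (hp : SosDeg d p) (hq : SosDeg e q) : SosDeg (d + e) (p * q) :=
  ⟨hp.1.mul hq.1, (totalDegree_mul _ _).trans (Nat.add_le_add hp.2 hq.2)⟩

lemma sq (hp : p.totalDegree ≤ d) : SosDeg (2 * d) (p ^ 2) :=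
  ⟨by rw [_root_.sq]; exact IsSumSq.mul_self p,
    (totalDegree_pow _ _).trans (Nat.mul_le_mul_left 2 hp)⟩

lemma const {r : ℝ} (hr : 0 ≤ r) : SosDeg d (C r : MvPolynomial V ℝ) := by
  refine ⟨?_, by simp⟩
  rw [← Real.mul_self_sqrt hr, C_mul]
  exact IsSumSq.mul_self _

lemma sum {ι : Type*} (s : Finset ι) (f : ι → MvPolynomial V ℝ) (h : ∀ i ∈ s, SosDeg d (f i)) :
    SosDeg d (∑ i ∈ s, f i) :=
  ⟨IsSumSq.sum fun i hi => (h i hi).1, totalDegree_finsetSum_le fun i hi => (h i hi).2⟩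

end SosDeg

/-- Substituting polynomials of degree at most one does not increase the total degree. -/
lemma totalDegree_aeval_le_of_le_one {τ : Type*} (D : τ → MvPolynomial V ℝ)
    (hD : ∀ k, (D k).totalDegree ≤ 1) (p : MvPolynomial τ ℝ) :
    (MvPolynomial.aeval D p).totalDegree ≤ p.totalDegree := by
  rw [MvPolynomial.aeval_def, MvPolynomial.eval₂_eq]
  refine totalDegree_finsetSum_le fun m hm => ?_
  refine (totalDegree_mul _ _).trans ?_
  rw [MvPolynomial.algebraMap_eq, totalDegree_C, zero_add]
  refine (totalDegree_finsetProd _ _).trans ?_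
  refine le_trans (Finset.sum_le_sum fun i _ => ?_) (le_totalDegree hm)
  exact (totalDegree_pow _ _).trans (by simpa using Nat.mul_le_mul_left (m i) (hD i))

lemma IsSumSq.map_ringHom {R S : Type*} [CommRing R] [CommRing S] (φ : R →+* S) {a : R}
    (ha : IsSumSq a) : IsSumSq (φ a) := by
  induction ha with
  | zero => simp
  | sq_add a _ ih =>
    rw [map_add, map_mul]
    exact (IsSumSq.mul_self _).add ih

lemma SosDeg.aeval {τ : Type*} {d : ℕ} {D : τ → MvPolynomial V ℝ}
    (hD : ∀ k, (D k).totalDegree ≤ 1) {p : MvPolynomial τ ℝ} (hp : SosDeg d p) :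
    SosDeg d (MvPolynomial.aeval D p) :=
  ⟨hp.1.map_ringHom (MvPolynomial.aeval D : MvPolynomial τ ℝ →ₐ[ℝ] _).toRingHom,
    (totalDegree_aeval_le_of_le_one D hD p).trans hp.2⟩

lemma totalDegree_polynomial_aeval_le {s : MvPolynomial V ℝ} {d : ℕ} (hs : s.totalDegree ≤ d)
    (p : Polynomial ℝ) : (Polynomial.aeval s p).totalDegree ≤ d * p.natDegree := by
  rw [Polynomial.aeval_eq_sum_range]
  refine totalDegree_finsetSum_le fun m hm => ?_
  refine (totalDegree_smul_le _ _).trans ((totalDegree_pow _ _).trans ?_)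
  rw [mul_comm]
  exact Nat.mul_le_mul hs (by simpa [Nat.lt_succ_iff] using hm)

lemma SosDeg.polynomial_aeval {s : MvPolynomial V ℝ} {d : ℕ} (hs : s.totalDegree ≤ d)
    {p : Polynomial ℝ} (hp : IsSumSq p) :
    SosDeg (d * p.natDegree) (Polynomial.aeval s p) :=
  ⟨hp.map_ringHom (Polynomial.aeval s : Polynomial ℝ →ₐ[ℝ] _).toRingHom,
    totalDegree_polynomial_aeval_le hs p⟩

end SosDeg

/-- If a real quadratic `a + 2 t b + t² c` is nonnegative for all `t`, then `b² ≤ a c`. -/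
lemma sq_le_mul_of_forall_nonneg {a b c : ℝ} (h : ∀ t : ℝ, 0 ≤ a + 2 * t * b + t ^ 2 * c) :
    b ^ 2 ≤ a * c := by
  have := discrim_le_zero (a := c) (b := 2 * b) (c := a) fun t => by linarith [h t]
  rw [discrim] at this
  linarith

/-- The functional `E` behaves like a pseudo-expectation of level `ℓ` in which `w` is Boolean
and `w * s ≤ δ²`. -/
structure LocalExpect {V : Type*} (ℓ : ℕ) (E : MvPolynomial V ℝ →ₗ[ℝ] ℝ)
    (w s : MvPolynomial V ℝ) (δ : ℝ) : Prop where
  w_deg : w.totalDegree ≤ 1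
  nonneg : ∀ h, SosDeg ℓ h → 0 ≤ E h
  mul_w_sq : ∀ h d, SosDeg d h → d + 2 ≤ ℓ → E (h * w ^ 2) = E (h * w)
  mul_resid : ∀ h d, SosDeg d h → d + 4 ≤ ℓ → 0 ≤ E (h * (C (δ ^ 2) - w * s))

namespace LocalExpect

variable {V : Type*} {ℓ : ℕ} {E : MvPolynomial V ℝ →ₗ[ℝ] ℝ} {w s : MvPolynomial V ℝ} {δ : ℝ}

lemma map_C_mul (E : MvPolynomial V ℝ →ₗ[ℝ] ℝ) (r : ℝ) (p : MvPolynomial V ℝ) :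
    E (C r * p) = r * E p := by
  rw [← smul_eq_C_mul, map_smul, smul_eq_mul]

lemma w_sq_sos (H : LocalExpect ℓ E w s δ) : SosDeg 2 (w ^ 2) := SosDeg.sq H.w_deg

lemma mul_w_nonneg (H : LocalExpect ℓ E w s δ) {h : MvPolynomial V ℝ} {d : ℕ}
    (hh : SosDeg d h) (hd : d + 2 ≤ ℓ) : 0 ≤ E (h * w) := by
  rw [← H.mul_w_sq h d hh hd]
  exact H.nonneg _ ((hh.mul H.w_sq_sos).mono hd)

lemma mul_w_cube (H : LocalExpect ℓ E w s δ) {h : MvPolynomial V ℝ} {d : ℕ}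
    (hh : SosDeg d h) (hd : d + 4 ≤ ℓ) : E (h * w ^ 3) = E (h * w) := by
  have h1 := H.mul_w_sq h d hh (by omega)
  have h2 := H.mul_w_sq (h * w ^ 2) (d + 2) (hh.mul H.w_sq_sos) (by omega)
  have hw1 : SosDeg 2 ((w + 1) ^ 2) := SosDeg.sq
    ((totalDegree_add _ _).trans (max_le H.w_deg (by simp)))
  have h3 := H.mul_w_sq (h * (w + 1) ^ 2) (d + 2) (hh.mul hw1) (by omega)
  have e3a : h * (w + 1) ^ 2 * w ^ 2 = h * w ^ 2 * w ^ 2 + (h * w ^ 3 + h * w ^ 3) + h * w ^ 2 := by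
    ring
  have e3b : h * (w + 1) ^ 2 * w = h * w ^ 3 + (h * w ^ 2 + h * w ^ 2) + h * w := by ring
  have e2 : h * w ^ 2 * w = h * w ^ 3 := by ring
  rw [e3a, e3b] at h3
  rw [e2] at h2
  simp only [map_add] at h3
  linarith

/-- Cauchy–Schwarz for `f` against `g * w`. -/
lemma cauchy_schwarz (H : LocalExpect ℓ E w s δ) {f g : MvPolynomial V ℝ} {a b : ℕ}
    (hf : f.totalDegree ≤ a) (hg : g.totalDegree ≤ b) (ha : 2 * a ≤ ℓ) (hb : 2 * b + 2 ≤ ℓ) :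
    E (f * g * w) ^ 2 ≤ E (f ^ 2) * E (g ^ 2 * w) := by
  refine sq_le_mul_of_forall_nonneg fun t => ?_
  have hdeg : (f + C t * (g * w)).totalDegree ≤ max a (b + 1) := by
    refine (totalDegree_add _ _).trans (max_le_max hf ?_)
    refine (totalDegree_mul _ _).trans ?_
    rw [totalDegree_C, zero_add]
    exact (totalDegree_mul _ _).trans (Nat.add_le_add hg H.w_deg)
  have h1 := H.nonneg _ ((SosDeg.sq hdeg).mono (by
    rcases max_cases a (b + 1) with h | h <;> omega))
  have h2 := H.mul_w_sq (g ^ 2) (2 * b) (SosDeg.sq hg) hb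
  have e : (f + C t * (g * w)) ^ 2
      = f ^ 2 + C (2 * t) * (f * g * w) + C (t ^ 2) * (g ^ 2 * w ^ 2) := by
    simp only [C_mul, C_pow]
    rw [show (C 2 : MvPolynomial V ℝ) = 2 from rfl]
    ring
  rw [e, map_add, map_add, map_C_mul, map_C_mul, h2] at h1
  exact h1

/-- The localized constraint `w (δ² - s) ≥ 0`. -/
lemma mul_w_resid (H : LocalExpect ℓ E w s δ) {h : MvPolynomial V ℝ} {d : ℕ}
    (hs : SosDeg 2 s) (hh : SosDeg d h) (hd : d + 6 ≤ ℓ) :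
    0 ≤ E (h * (C (δ ^ 2) - s) * w) := by
  have h1 := H.mul_resid (h * w ^ 2) (d + 2) (hh.mul H.w_sq_sos) (by omega)
  have h2 := H.mul_w_sq h d hh (by omega)
  have h3 := H.mul_w_cube (hh.mul hs) (by omega)
  have e1 : h * w ^ 2 * (C (δ ^ 2) - w * s) = C (δ ^ 2) * (h * w ^ 2) - h * s * w ^ 3 := by ring
  have e2 : h * (C (δ ^ 2) - s) * w = C (δ ^ 2) * (h * w) - h * s * w := by ring
  rw [e1, map_sub, map_C_mul, h2, h3] at h1
  rw [e2, map_sub, map_C_mul]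
  exact h1

/-- Univariate polynomials nonnegative on `[0, δ²]` may be evaluated at `s` under `w`. -/
lemma aeval_nonneg (H : LocalExpect ℓ E w s δ) (hs : SosDeg 2 s) (hδ : 0 < δ)
    {L : MvPolynomial V ℝ} (hL : L.totalDegree ≤ 1) {f : Polynomial ℝ}
    {m : ℕ} (hm : 2 ≤ m) (hmℓ : 4 * m + 2 ≤ ℓ) (hfm : f.natDegree ≤ m)
    (hf : ∀ t ∈ Set.Icc 0 (δ ^ 2), 0 ≤ f.eval t) :
    0 ≤ E (L ^ 2 * Polynomial.aeval s f * w) := by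
  obtain ⟨σ₀, σ₁, σ₂, σ₃, h0, h1, h2, h3, d0, d1, d2, d3, hfe⟩ :=
    (IntervalCone.of_nonneg (by positivity) f hf).mono hfm
  have hL2 := SosDeg.sq hL
  have i0 := H.mul_w_nonneg (hL2.mul (SosDeg.polynomial_aeval hs.2 h0)) (by omega)
  have i1 : 0 ≤ E (L ^ 2 * s * Polynomial.aeval s σ₁ * w) := by
    rcases d1 with rfl | d1
    · simp
    · exact H.mul_w_nonneg ((hL2.mul hs).mul (SosDeg.polynomial_aeval hs.2 h1)) (by omega)
  have i2 : 0 ≤ E (L ^ 2 * Polynomial.aeval s σ₂ * (C (δ ^ 2) - s) * w) := by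
    rcases d2 with rfl | d2
    · simp
    · exact H.mul_w_resid hs (hL2.mul (SosDeg.polynomial_aeval hs.2 h2)) (by omega)
  have i3 : 0 ≤ E (L ^ 2 * s * Polynomial.aeval s σ₃ * (C (δ ^ 2) - s) * w) := by
    rcases d3 with rfl | d3
    · simp
    · exact H.mul_w_resid hs ((hL2.mul hs).mul (SosDeg.polynomial_aeval hs.2 h3)) (by omega)
  have e : L ^ 2 * Polynomial.aeval s f * w
      = L ^ 2 * Polynomial.aeval s σ₀ * w + L ^ 2 * s * Polynomial.aeval s σ₁ * w
        + L ^ 2 * Polynomial.aeval s σ₂ * (C (δ ^ 2) - s) * w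
        + L ^ 2 * s * Polynomial.aeval s σ₃ * (C (δ ^ 2) - s) * w := by
    rw [hfe]
    simp only [map_add, map_mul, map_sub, Polynomial.aeval_X, Polynomial.aeval_C,
      MvPolynomial.algebraMap_eq]
    ring
  rw [e, map_add, map_add, map_add]
  linarith

lemma sq_le_of_two_le_natDegree (H : LocalExpect ℓ E w s δ) (hs : SosDeg 2 s) (hδ : 0 < δ)
    {L : MvPolynomial V ℝ} (hL : L.totalDegree ≤ 1) {q : Polynomial ℝ}
    (hm : 2 ≤ q.natDegree) (hmℓ : 4 * q.natDegree + 2 ≤ ℓ) {c : ℝ} (hc : 0 < c)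
    (hq : ∀ t ∈ Set.Icc 0 (δ ^ 2), c ≤ q.eval t) :
    c ^ 2 * E (L * w) ^ 2 ≤ E w * E (L ^ 2 * Polynomial.aeval s q ^ 2) := by
  have hLq : (L * Polynomial.aeval s q).totalDegree ≤ 1 + 2 * q.natDegree :=
    (totalDegree_mul _ _).trans (Nat.add_le_add hL (totalDegree_polynomial_aeval_le hs.2 q))
  have b1 := H.cauchy_schwarz hLq hL (by omega) (by omega)
  have b2 := H.aeval_nonneg hs hδ hL (f := q - Polynomial.C c) hm hmℓ
    ((Polynomial.natDegree_sub_le _ _).trans (by simp)) (fun t ht => by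
      rw [Polynomial.eval_sub, Polynomial.eval_C]; linarith [hq t ht])
  have e1 : L * Polynomial.aeval s q * L * w = L ^ 2 * Polynomial.aeval s q * w := by ring
  have e2 : L ^ 2 * Polynomial.aeval s (q - Polynomial.C c) * w
      = L ^ 2 * Polynomial.aeval s q * w - C c * (L ^ 2 * w) := by
    rw [map_sub, Polynomial.aeval_C, MvPolynomial.algebraMap_eq]; ring
  rw [e1, mul_pow] at b1
  rw [e2, map_sub, map_C_mul] at b2
  have hB : 0 ≤ E (L ^ 2 * w) := H.mul_w_nonneg (SosDeg.sq hL) (by omega)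
  have hW : 0 ≤ E w := by
    have := H.mul_w_nonneg (SosDeg.const (d := 0) zero_le_one) (by omega)
    simpa using this
  have b3 : E (L * w) ^ 2 ≤ E w * E (L ^ 2 * w) := by
    refine sq_le_mul_of_forall_nonneg fun t => ?_
    have hd : (1 + C t * L).totalDegree ≤ 1 := by
      refine (totalDegree_add _ _).trans (max_le (by simp) ?_)
      refine (totalDegree_mul _ _).trans ?_
      simpa using hL
    have h1 := H.mul_w_nonneg (SosDeg.sq hd) (by omega)
    have e : (1 + C t * L) ^ 2 * w = w + C (2 * t) * (L * w) + C (t ^ 2) * (L ^ 2 * w) := by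
      simp only [C_mul, C_pow]
      rw [show (C 2 : MvPolynomial V ℝ) = 2 from rfl]
      ring
    rwa [e, map_add, map_add, map_C_mul, map_C_mul] at h1
  rcases hB.eq_or_lt with h0 | h0
  · rw [← h0, mul_zero] at b3
    have : E (L * w) ^ 2 = 0 := le_antisymm b3 (sq_nonneg _)
    rw [this, mul_zero]
    exact mul_nonneg hW (H.nonneg _ (by
      rw [← mul_pow]; exact (SosDeg.sq hLq).mono (by omega)))
  · set A := E (L ^ 2 * Polynomial.aeval s q ^ 2)
    set B := E (L ^ 2 * w)
    have h4 : (c * B) ^ 2 ≤ A * B :=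
      (pow_le_pow_left₀ (by positivity) (by linarith) 2).trans b1
    have h5 : c ^ 2 * B ≤ A := by
      refine le_of_mul_le_mul_right (a := B) ?_ h0
      linarith
    calc c ^ 2 * E (L * w) ^ 2 ≤ c ^ 2 * (E w * B) := by gcongr
      _ = E w * (c ^ 2 * B) := by ring
      _ ≤ E w * A := by gcongr

lemma sq_le (H : LocalExpect ℓ E w s δ) {f : MvPolynomial V ℝ} {a : ℕ}
    (hf : f.totalDegree ≤ a) (ha : 2 * a ≤ ℓ) (hℓ : 2 ≤ ℓ) :
    E (f * w) ^ 2 ≤ E w * E (f ^ 2) := by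
  have := H.cauchy_schwarz hf (g := 1) (b := 0) (by simp) ha hℓ
  rwa [mul_one, one_pow, one_mul, mul_comm (E (f ^ 2))] at this

/-- The estimate for an affine increasing `q`. -/
lemma sq_le_of_affine_nonneg (H : LocalExpect ℓ E w s δ) (hs : SosDeg 2 s)
    {L : MvPolynomial V ℝ} (hL : L.totalDegree ≤ 1) (hℓ : 6 ≤ ℓ) {a : ℝ} (ha : 0 ≤ a) :
    E (L * w) ^ 2 ≤ E w * E (L ^ 2 * (1 + C a * s) ^ 2) := by
  have hW : 0 ≤ E w := by
    have := H.mul_w_nonneg (SosDeg.const (d := 0) zero_le_one) (by omega)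
    simpa using this
  refine (H.sq_le hL (by omega) (by omega)).trans (mul_le_mul_of_nonneg_left ?_ hW)
  have h1 := H.nonneg _ (((SosDeg.sq hL).mul hs).mono (by omega))
  have h2 := H.nonneg _ ((((SosDeg.sq hL).mul hs).mul hs).mono (by omega))
  have e : L ^ 2 * (1 + C a * s) ^ 2
      = L ^ 2 + C (2 * a) * (L ^ 2 * s) + C (a ^ 2) * (L ^ 2 * s * s) := by
    simp only [C_mul, C_pow]
    rw [show (C 2 : MvPolynomial V ℝ) = 2 from rfl]
    ring
  rw [e, map_add, map_add, map_C_mul, map_C_mul]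
  have := mul_nonneg ha h1
  nlinarith [mul_nonneg (sq_nonneg a) h2]

/-- The estimate for an affine decreasing `q`. -/
lemma sq_le_of_affine_nonpos (H : LocalExpect ℓ E w s δ) {ι : Type*} {J : Finset ι}
    {a : ι → MvPolynomial V ℝ} (ha : ∀ j ∈ J, (a j).totalDegree ≤ 1)
    (hsa : s = ∑ j ∈ J, a j ^ 2)
    {L : MvPolynomial V ℝ} (hL : L.totalDegree ≤ 1) (hℓ : 6 ≤ ℓ) {β τ : ℝ} (hβ : 0 ≤ β)
    (hτ : β * δ ^ 2 ≤ τ) :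
    E (L * w) ^ 2 ≤ E w * (2 * τ ^ 2 * E (L ^ 2) + 2 * E (L ^ 2 * (1 - C β * s) ^ 2)) := by
  have hs : SosDeg 2 s := by
    rw [hsa]; exact SosDeg.sum _ _ fun j hj => SosDeg.sq (ha j hj)
  have hW : 0 ≤ E w := by
    have := H.mul_w_nonneg (SosDeg.const (d := 0) zero_le_one) (by omega)
    simpa using this
  have hq : (1 - C β * s).totalDegree ≤ 2 := by
    refine (totalDegree_sub _ _).trans (max_le (by simp) ?_)
    refine (totalDegree_mul _ _).trans ?_
    simpa using hs.2
  have h1 := H.sq_le (f := L * (1 - C β * s)) (a := 3)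
    ((totalDegree_mul _ _).trans (Nat.add_le_add hL hq)) (by omega) (by omega)
  have h2 : E (L * s * w) ^ 2 ≤ E (L ^ 2 * s * w) * E (s * w) := by
    refine sq_le_mul_of_forall_nonneg fun t => ?_
    have hd : (L + C t).totalDegree ≤ 1 :=
      (totalDegree_add _ _).trans (max_le hL (by simp))
    have h := H.mul_w_nonneg ((SosDeg.sq hd).mul hs) (by omega)
    have e : (L + C t) ^ 2 * s * w
        = L ^ 2 * s * w + C (2 * t) * (L * s * w) + C (t ^ 2) * (s * w) := by
      simp only [C_mul, C_pow]
      rw [show (C 2 : MvPolynomial V ℝ) = 2 from rfl]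
      ring
    rwa [e, map_add, map_add, map_C_mul, map_C_mul] at h
  have h3 := H.mul_resid (L ^ 2) 2 (SosDeg.sq hL) (by omega)
  have e3 : L ^ 2 * (C (δ ^ 2) - w * s) = C (δ ^ 2) * L ^ 2 - L ^ 2 * s * w := by ring
  rw [e3, map_sub, map_C_mul] at h3
  have h4 := H.mul_w_resid hs (SosDeg.const (d := 0) zero_le_one) (by omega)
  have e4 : C 1 * (C (δ ^ 2) - s) * w = C (δ ^ 2) * w - s * w := by
    rw [C_1]; ring
  rw [e4, map_sub, map_C_mul] at h4
  have h5 : 0 ≤ E (L ^ 2 * s * w) := H.mul_w_nonneg ((SosDeg.sq hL).mul hs) (by omega)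
  have h6 : 0 ≤ E (L ^ 2) := H.nonneg _ ((SosDeg.sq hL).mono (by omega))
  have h7 : E (L * s * w) ^ 2 ≤ (δ ^ 2 * E (L ^ 2)) * (δ ^ 2 * E w) :=
    h2.trans (mul_le_mul (by linarith) (by linarith)
      (H.mul_w_nonneg hs (by omega)) (by positivity))
  have e8 : L * (1 - C β * s) * w = L * w - C β * (L * s * w) := by ring
  rw [e8, map_sub, map_C_mul, mul_pow] at h1
  have h9 : (β * E (L * s * w)) ^ 2 ≤ τ ^ 2 * (E (L ^ 2) * E w) := by
    calc (β * E (L * s * w)) ^ 2 = β ^ 2 * E (L * s * w) ^ 2 := by ring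
      _ ≤ β ^ 2 * ((δ ^ 2 * E (L ^ 2)) * (δ ^ 2 * E w)) := by gcongr
      _ = (β * δ ^ 2) ^ 2 * (E (L ^ 2) * E w) := by ring
      _ ≤ τ ^ 2 * (E (L ^ 2) * E w) := by gcongr
  nlinarith [sq_nonneg (E (L * w) - 2 * (β * E (L * s * w)))]

end LocalExpect

section AntiConcentration

variable {n dx dy : ℕ}

lemma IsSOS.eval_nonneg {V : Type*} {p : MvPolynomial V ℝ} (hp : IsSOS p) (x : V → ℝ) :
    0 ≤ MvPolynomial.eval x p := by
  obtain ⟨N, q, rfl⟩ := hp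
  simp only [map_sum, map_pow]
  positivity

lemma SosProof.eval_nonneg {V ι : Type*} [Fintype ι] [DecidableEq ι]
    {A : ι → MvPolynomial V ℝ} {k : ℕ} {g : MvPolynomial V ℝ} (h : SosProof A k g) (x : V → ℝ)
    (hx : ∀ i, 0 ≤ MvPolynomial.eval x (A i)) : 0 ≤ MvPolynomial.eval x g := by
  obtain ⟨P, hP, rfl, -⟩ := h
  simp only [map_sum, map_mul, map_prod]
  exact Finset.sum_nonneg fun S _ =>
    mul_nonneg ((hP S).eval_nonneg x) (Finset.prod_nonneg fun i _ => hx i)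

lemma SosProof.totalDegree_le {V ι : Type*} [Fintype ι] [DecidableEq ι]
    {A : ι → MvPolynomial V ℝ} {k : ℕ} {g : MvPolynomial V ℝ} (h : SosProof A k g) :
    g.totalDegree ≤ k := by
  obtain ⟨P, -, rfl, hd⟩ := h
  exact totalDegree_finsetSum_le fun S _ => hd S

lemma eval_normAPoly (A : Fin n → Matrix (Fin dx) (Fin dy) ℝ) (i : Fin n) (v : Fin dx → ℝ) :
    MvPolynomial.eval v (normAPoly A i) = ∑ j, (∑ k, A i k j * v k) ^ 2 := by
  simp [normAPoly]

lemma eval_normAPoly_nonneg (A : Fin n → Matrix (Fin dx) (Fin dy) ℝ) (i : Fin n)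
    (v : Fin dx → ℝ) : 0 ≤ MvPolynomial.eval v (normAPoly A i) := by
  rw [eval_normAPoly]; positivity

lemma eval_smul_normAPoly (A : Fin n → Matrix (Fin dx) (Fin dy) ℝ) (i : Fin n) (r : ℝ)
    (v : Fin dx → ℝ) :
    MvPolynomial.eval (r • v) (normAPoly A i) = r ^ 2 * MvPolynomial.eval v (normAPoly A i) := by
  simp only [eval_normAPoly, Finset.mul_sum, Pi.smul_apply, smul_eq_mul]
  refine Finset.sum_congr rfl fun j _ => ?_
  rw [← mul_pow, Finset.mul_sum]
  congr 1
  exact Finset.sum_congr rfl fun k _ => by ring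

lemma eval_vnormPoly (v : Fin dx → ℝ) : MvPolynomial.eval v (vnormPoly dx) = ∑ k, v k ^ 2 := by
  simp [vnormPoly]

lemma eval_polynomial_aeval {V : Type*} (v : V → ℝ) (s : MvPolynomial V ℝ) (q : Polynomial ℝ) :
    MvPolynomial.eval v (Polynomial.aeval s q) = q.eval (MvPolynomial.eval v s) := by
  have := Polynomial.aeval_algHom_apply (MvPolynomial.aeval v : MvPolynomial V ℝ →ₐ[ℝ] ℝ) s q
  simpa [MvPolynomial.aeval_eq_eval] using this.symm

/-- The polynomials `p(‖A_iᵀ v‖)²` average, weighted by `‖v‖²`. -/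
def anticoncPoly (A : Fin n → Matrix (Fin dx) (Fin dy) ℝ) (I : Finset (Fin n))
    (q : Polynomial ℝ) : MvPolynomial (Fin dx) ℝ :=
  vnormPoly dx * (C ((I.card : ℝ)⁻¹) * ∑ i ∈ I, Polynomial.aeval (normAPoly A i) q ^ 2)

lemma eval_anticoncPoly (A : Fin n → Matrix (Fin dx) (Fin dy) ℝ) (I : Finset (Fin n))
    (q : Polynomial ℝ) (v : Fin dx → ℝ) :
    MvPolynomial.eval v (anticoncPoly A I q) = (∑ k, v k ^ 2) *
      ((I.card : ℝ)⁻¹ * ∑ i ∈ I, q.eval (MvPolynomial.eval v (normAPoly A i)) ^ 2) := by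
  simp only [anticoncPoly, map_mul, map_sum, map_pow, eval_C, eval_vnormPoly,
    eval_polynomial_aeval]

/-- Restriction of a polynomial to the line spanned by `u`. -/
def lineRestrict (u : Fin dx → ℝ) : MvPolynomial (Fin dx) ℝ →ₐ[ℝ] Polynomial ℝ :=
  MvPolynomial.aeval fun k => Polynomial.C (u k) * Polynomial.X

lemma natDegree_lineRestrict_le (u : Fin dx → ℝ) (p : MvPolynomial (Fin dx) ℝ) :
    (lineRestrict u p).natDegree ≤ p.totalDegree := by
  have := MvPolynomial.aeval_natDegree_le (n := 1) p le_rfl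
    (fun k => Polynomial.C (u k) * Polynomial.X)
    (fun k => (Polynomial.natDegree_C_mul_le _ _).trans Polynomial.natDegree_X_le)
  simpa [lineRestrict] using this

lemma lineRestrict_vnormPoly (u : Fin dx → ℝ) :
    lineRestrict u (vnormPoly dx) = Polynomial.C (∑ k, u k ^ 2) * Polynomial.X ^ 2 := by
  simp [lineRestrict, vnormPoly, mul_pow, Finset.sum_mul]

lemma lineRestrict_normAPoly (A : Fin n → Matrix (Fin dx) (Fin dy) ℝ) (i : Fin n)
    (u : Fin dx → ℝ) :
    lineRestrict u (normAPoly A i)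
      = Polynomial.C (MvPolynomial.eval u (normAPoly A i)) * Polynomial.X ^ 2 := by
  rw [eval_normAPoly]
  simp only [lineRestrict, normAPoly, map_sum, map_pow, map_mul, aeval_X,
    MvPolynomial.algHom_C, Finset.sum_mul]
  refine Finset.sum_congr rfl fun j _ => ?_
  rw [← mul_pow, Finset.sum_mul]
  congr 1
  refine Finset.sum_congr rfl fun k _ => ?_
  rw [Polynomial.algebraMap_eq]; ring

lemma lineRestrict_C (u : Fin dx → ℝ) (r : ℝ) : lineRestrict u (C r) = Polynomial.C r := by
  simp [lineRestrict]

lemma coeff_comp_sq (q : Polynomial ℝ) (r : ℝ) :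
    ((q.comp (Polynomial.C r * Polynomial.X ^ 2)) ^ 2).coeff (4 * q.natDegree)
      = (q.leadingCoeff * r ^ q.natDegree) ^ 2 := by
  have h1 : q.comp (Polynomial.C r * Polynomial.X ^ 2)
      = Polynomial.expand ℝ 2 (q.comp (Polynomial.C r * Polynomial.X)) := by
    rw [Polynomial.expand_eq_comp_X_pow, Polynomial.comp_assoc]
    simp
  have hdeg : (q.comp (Polynomial.C r * Polynomial.X ^ 2)).natDegree ≤ q.natDegree * 2 :=
    Polynomial.natDegree_comp_le.trans
      (Nat.mul_le_mul_left _ (Polynomial.natDegree_C_mul_X_pow_le _ _))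
  rw [show 4 * q.natDegree = 2 * (q.natDegree * 2) by ring,
    Polynomial.coeff_pow_of_natDegree_le hdeg, h1,
    Polynomial.coeff_expand_mul (by norm_num), Polynomial.comp_C_mul_X_coeff]
  rfl

lemma four_mul_natDegree_add_two_le {A : Fin n → Matrix (Fin dx) (Fin dy) ℝ}
    {I : Finset (Fin n)} {q : Polynomial ℝ} {K : ℝ} {k : ℕ} (hq0 : q ≠ 0)
    (hdeg : (C K - anticoncPoly A I q).totalDegree ≤ k) {i : Fin n} (hi : i ∈ I)
    {u : Fin dx → ℝ} (hu : MvPolynomial.eval u (normAPoly A i) ≠ 0) :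
    4 * q.natDegree + 2 ≤ k := by
  by_contra! hlt
  have h1 := Polynomial.coeff_eq_zero_of_natDegree_lt
    (((natDegree_lineRestrict_le u _).trans hdeg).trans_lt hlt)
  have hu2 : 0 < ∑ k, u k ^ 2 := by
    refine lt_of_le_of_ne (by positivity) fun h0 => hu ?_
    have hz : ∀ k, u k = 0 := fun k => by
      have := (Finset.sum_eq_zero_iff_of_nonneg (fun k _ => sq_nonneg (u k))).1 h0.symm k
        (Finset.mem_univ k)
      simpa using this
    simp [eval_normAPoly, hz]
  have hcard : 0 < (I.card : ℝ)⁻¹ := by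
    have : 0 < I.card := Finset.card_pos.2 ⟨i, hi⟩
    positivity
  have hkey : lineRestrict u (C K - anticoncPoly A I q) = Polynomial.C K
      - Polynomial.C ((∑ k, u k ^ 2) * (I.card : ℝ)⁻¹) *
        ((∑ i ∈ I, q.comp (Polynomial.C (MvPolynomial.eval u (normAPoly A i))
          * Polynomial.X ^ 2) ^ 2) * Polynomial.X ^ 2) := by
    have hsum : lineRestrict u (∑ i ∈ I, Polynomial.aeval (normAPoly A i) q ^ 2)
        = ∑ i ∈ I, q.comp (Polynomial.C (MvPolynomial.eval u (normAPoly A i))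
          * Polynomial.X ^ 2) ^ 2 := by
      rw [map_sum]
      refine Finset.sum_congr rfl fun j _ => ?_
      rw [map_pow, ← Polynomial.aeval_algHom_apply, lineRestrict_normAPoly,
        Polynomial.comp_eq_aeval]
    rw [map_sub, lineRestrict_C, anticoncPoly, map_mul, map_mul, lineRestrict_vnormPoly,
      lineRestrict_C, hsum, Polynomial.C_mul]
    ring
  rw [hkey, Polynomial.coeff_sub, Polynomial.coeff_C, if_neg (by omega), Polynomial.coeff_C_mul,
    Polynomial.coeff_mul_X_pow, Polynomial.finsetSum_coeff] at h1
  simp only [coeff_comp_sq] at h1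
  have h2 : 0 < ∑ i ∈ I,
      (q.leadingCoeff * MvPolynomial.eval u (normAPoly A i) ^ q.natDegree) ^ 2 := by
    refine Finset.sum_pos' (fun _ _ => sq_nonneg _) ⟨i, hi, ?_⟩
    have := Polynomial.leadingCoeff_ne_zero.2 hq0
    positivity
  have h3 := mul_pos (mul_pos hu2 hcard) h2
  linarith

/-- The content of certifiable anti-concentration used below, with a bound on the degree of the
univariate polynomial. -/
lemma AntiConcentrated.exists_bounded {A : Fin n → Matrix (Fin dx) (Fin dy) ℝ}
    {I : Finset (Fin n)} {k : ℕ} {Cc δ M : ℝ} (h : AntiConcentrated A I k Cc δ M)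
    (hI : I.Nonempty) (hk : 2 ≤ k) :
    ∃ q : Polynomial ℝ, q.eval 0 = 1 ∧
      (∀ t ∈ Set.Icc 0 (δ ^ 2), (1 - δ) ^ 2 ≤ q.eval t ^ 2) ∧ 4 * q.natDegree + 2 ≤ k ∧
      SosProof (fun _ : Fin 1 => C (M ^ 2) - vnormPoly dx) k
        (C (Cc * δ * M ^ 2) - anticoncPoly A I q) := by
  obtain ⟨p, q, hpq, hp0, h1, h2⟩ := h
  have hq0 : q.eval 0 = 1 := by have := hpq 0; simp_all
  by_cases hA : ∃ i ∈ I, ∃ u, MvPolynomial.eval u (normAPoly A i) ≠ 0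
  · obtain ⟨i, hi, u, hu⟩ := hA
    refine ⟨q, hq0, fun t ht => ?_, four_mul_natDegree_add_two_le ?_ h2.totalDegree_le hi hu, h2⟩
    · have hs : 0 < MvPolynomial.eval u (normAPoly A i) :=
        lt_of_le_of_ne (eval_normAPoly_nonneg A i u) hu.symm
      have ht' : MvPolynomial.eval
          (Real.sqrt (t / MvPolynomial.eval u (normAPoly A i)) • u) (normAPoly A i) = t := by
        rw [eval_smul_normAPoly, Real.sq_sqrt (div_nonneg ht.1 hs.le), div_mul_cancel₀ _ hu]
      have := (h1 i hi).eval_nonneg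
        (Real.sqrt (t / MvPolynomial.eval u (normAPoly A i)) • u)
        (fun _ => by simpa [ht'] using ht.2)
      simp only [map_sub, map_pow, eval_polynomial_aeval, eval_C, ht'] at this
      linarith
    · rintro rfl
      simp at hq0
  · push Not at hA
    have hz : ∀ i ∈ I, normAPoly A i = 0 := fun i hi =>
      MvPolynomial.funext fun u => by rw [hA i hi u, map_zero]
    refine ⟨1, by simp, fun t ht => ?_, by simpa using hk, ?_⟩
    · obtain ⟨i, hi⟩ := hI
      have := (h1 i hi).eval_nonneg 0 (fun _ => by
        rw [hz i hi]; simpa using sq_nonneg δ)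
      simp only [map_sub, map_pow, eval_polynomial_aeval, eval_C, hA i hi, hq0] at this
      simpa using this
    · have e : anticoncPoly A I 1 = anticoncPoly A I q := by
        rw [anticoncPoly, anticoncPoly]
        congr 2
        refine Finset.sum_congr rfl fun i hi => ?_
        have e1 : Polynomial.aeval (0 : MvPolynomial (Fin dx) ℝ) q = 1 := by
          rw [Polynomial.aeval_def, Polynomial.eval₂_at_zero,
            Polynomial.coeff_zero_eq_eval_zero, hq0, map_one]
        rw [hz i hi, e1, map_one]
      rw [e]; exact h2

/-- A polynomial with `q 0 = 1` and `q² ≥ a² > 0` on an interval is at least `|a|` there. -/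
lemma abs_le_eval_of_sq_le {q : Polynomial ℝ} (hq0 : q.eval 0 = 1) {a b : ℝ} (ha : a ≠ 0)
    (h : ∀ t ∈ Set.Icc 0 b, a ^ 2 ≤ q.eval t ^ 2) : ∀ t ∈ Set.Icc 0 b, |a| ≤ q.eval t := by
  intro t ht
  by_contra! hlt
  have h1 := sq_le_sq.1 (h t ht)
  have hapos : 0 < |a| := abs_pos.2 ha
  have hneg : q.eval t < 0 := by
    by_contra! hge
    rw [abs_of_nonneg hge] at h1
    linarith
  obtain ⟨u, hu, hu0⟩ := intermediate_value_Icc' ht.1 (f := fun t => q.eval t)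
    q.continuous.continuousOn (show (0 : ℝ) ∈ Set.Icc (q.eval t) (q.eval 0) from
      ⟨hneg.le, by rw [hq0]; exact zero_le_one⟩)
  have h2 := h u ⟨hu.1, hu.2.trans ht.2⟩
  simp only at hu0
  rw [hu0] at h2
  have : 0 < a ^ 2 := by positivity
  linarith

lemma SosProof.sum_eval_sq_le {A : Fin n → Matrix (Fin dx) (Fin dy) ℝ} {I : Finset (Fin n)}
    {k : ℕ} {K M : ℝ} {q : Polynomial ℝ} (hdx : 0 < dx)
    (h : SosProof (fun _ : Fin 1 => C (M ^ 2) - vnormPoly dx) k (C K - anticoncPoly A I q))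
    (hI : I.Nonempty) (t : ℝ) (ht : t ^ 2 ≤ M ^ 2) :
    t ^ 2 * ∑ i ∈ I, q.eval (t ^ 2 *
      MvPolynomial.eval (Pi.single ⟨0, hdx⟩ 1) (normAPoly A i)) ^ 2 ≤ I.card * K := by
  have hn : ∑ k, (t • (Pi.single ⟨0, hdx⟩ 1 : Fin dx → ℝ)) k ^ 2 = t ^ 2 := by
    rw [Finset.sum_eq_single ⟨0, hdx⟩]
    · simp
    · intro b _ hb
      simp [Pi.single_eq_of_ne hb]
    · simp
  have h1 := h.eval_nonneg (t • (Pi.single ⟨0, hdx⟩ 1 : Fin dx → ℝ)) (fun _ => by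
    rw [map_sub, eval_C, eval_vnormPoly, hn]; linarith)
  rw [map_sub, eval_C, eval_anticoncPoly, hn] at h1
  simp only [eval_smul_normAPoly] at h1
  have hc : (0 : ℝ) < I.card := by exact_mod_cast hI.card_pos
  calc _ = I.card * (t ^ 2 * ((I.card : ℝ)⁻¹ * ∑ i ∈ I, q.eval (t ^ 2 *
      MvPolynomial.eval (Pi.single ⟨0, hdx⟩ 1) (normAPoly A i)) ^ 2)) := by
        field_simp
    _ ≤ _ := by
        apply mul_le_mul_of_nonneg_left _ hc.le
        linarith

lemma SosProof.anticonc_pos {A : Fin n → Matrix (Fin dx) (Fin dy) ℝ} {I : Finset (Fin n)}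
    {k : ℕ} {K M : ℝ} {q : Polynomial ℝ} (hdx : 0 < dx) (hM : 0 < M) (hq0 : q.eval 0 = 1)
    (h : SosProof (fun _ : Fin 1 => C (M ^ 2) - vnormPoly dx) k (C K - anticoncPoly A I q))
    (hI : I.Nonempty) : 0 < K := by
  obtain ⟨i, hi⟩ := hI
  set r := MvPolynomial.eval (Pi.single ⟨0, hdx⟩ 1) (normAPoly A i)
  have hcont : Continuous fun t : ℝ => q.eval (t ^ 2 * r) :=
    q.continuous.comp (by fun_prop)
  have hev : ∀ᶠ t in nhds (0 : ℝ), 0 < q.eval (t ^ 2 * r) :=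
    hcont.continuousAt.eventually (lt_mem_nhds (by simp [hq0]))
  obtain ⟨ε, hε, hball⟩ := Metric.eventually_nhds_iff.1 hev
  have hmin : 0 < min M (ε / 2) := lt_min hM (by linarith)
  have h1 := hball (y := min M (ε / 2)) (by
    rw [Real.dist_eq, sub_zero, abs_of_pos hmin]
    linarith [min_le_right M (ε / 2)])
  have h2 := h.sum_eval_sq_le hdx ⟨i, hi⟩ (min M (ε / 2))
    (pow_le_pow_left₀ hmin.le (min_le_left _ _) 2)
  have h3 : 0 < ∑ j ∈ I, q.eval (min M (ε / 2) ^ 2 *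
      MvPolynomial.eval (Pi.single ⟨0, hdx⟩ 1) (normAPoly A j)) ^ 2 :=
    Finset.sum_pos' (fun _ _ => sq_nonneg _) ⟨i, hi, pow_pos h1 2⟩
  have hc : (0 : ℝ) < I.card := by exact_mod_cast Finset.card_pos.2 ⟨i, hi⟩
  have h4 : 0 < I.card * K := (mul_pos (pow_pos hmin 2) h3).trans_le h2
  exact pos_of_mul_pos_right h4 hc.le

/-- With an affine polynomial `q`, the anti-concentration constant is at least `1 / 9`. -/
lemma SosProof.anticonc_affine {A : Fin n → Matrix (Fin dx) (Fin dy) ℝ} {I : Finset (Fin n)}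
    {k : ℕ} {K M a : ℝ} {q : Polynomial ℝ} (hdx : 0 < dx)
    (hq : ∀ t, q.eval t = 1 + a * t)
    (h : SosProof (fun _ : Fin 1 => C (M ^ 2) - vnormPoly dx) k (C K - anticoncPoly A I q))
    (hI : I.Nonempty) : M ^ 2 ≤ 9 * K := by
  have h1 := h.sum_eval_sq_le hdx hI M le_rfl
  have h2 := h.sum_eval_sq_le hdx hI (M / 2) (by nlinarith [sq_nonneg M])
  have hc : (0 : ℝ) < I.card := by exact_mod_cast hI.card_pos
  have h3 : I.card * M ^ 2 ≤ 8 * ((M / 2) ^ 2 * ∑ i ∈ I, q.eval ((M / 2) ^ 2 *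
      MvPolynomial.eval (Pi.single ⟨0, hdx⟩ 1) (normAPoly A i)) ^ 2)
      + M ^ 2 * ∑ i ∈ I, q.eval (M ^ 2 *
      MvPolynomial.eval (Pi.single ⟨0, hdx⟩ 1) (normAPoly A i)) ^ 2 := by
    rw [Finset.mul_sum, Finset.mul_sum, Finset.mul_sum, ← Finset.sum_add_distrib,
      ← nsmul_eq_mul]
    refine Finset.card_nsmul_le_sum _ _ _ fun i _ => ?_
    rw [hq, hq]
    generalize MvPolynomial.eval (Pi.single ⟨0, hdx⟩ 1) (normAPoly A i) = r
    nlinarith [sq_nonneg (M / 2 * (1 + a * ((M / 2) ^ 2 * r)) + M * (1 + a * (M ^ 2 * r)))]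
  have h4 : I.card * M ^ 2 ≤ I.card * (9 * K) := by linarith
  exact le_of_mul_le_mul_left h4 hc

end AntiConcentration

section PseudoExpectation

variable {V : Type*}

/-- The pseudo-expectation as a linear functional on polynomials. -/
def pseudoExp (μ : (V → ℝ) →₀ ℝ) : MvPolynomial V ℝ →ₗ[ℝ] ℝ where
  toFun p := pExpect μ fun z => MvPolynomial.eval z p
  map_add' p q := by simp [pExpect, mul_add, Finset.sum_add_distrib]
  map_smul' r p := by
    simp only [pExpect, smul_eval, RingHom.id_apply, smul_eq_mul, Finset.mul_sum]
    exact Finset.sum_congr rfl fun z _ => by ring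

lemma pseudoExp_apply (μ : (V → ℝ) →₀ ℝ) (p : MvPolynomial V ℝ) :
    pseudoExp μ p = pExpect μ fun z => MvPolynomial.eval z p := rfl

lemma pseudoExp_one {μ : (V → ℝ) →₀ ℝ} {ℓ : ℕ} (h : IsPseudoDist μ ℓ) : pseudoExp μ 1 = 1 := by
  rw [pseudoExp_apply, pExpect]
  simpa using h.1

lemma pseudoExp_C {μ : (V → ℝ) →₀ ℝ} {ℓ : ℕ} (h : IsPseudoDist μ ℓ) (r : ℝ) :
    pseudoExp μ (C r) = r := by
  have := LocalExpect.map_C_mul (pseudoExp μ) r 1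
  rwa [mul_one, pseudoExp_one h, mul_one] at this

variable {ι : Type*} [Fintype ι] [DecidableEq ι] {μ : (V → ℝ) →₀ ℝ} {ℓ : ℕ}
  {A : ι → MvPolynomial V ℝ}

lemma PDSatisfies.sos_nonneg (h : PDSatisfies μ ℓ A 0) (p : MvPolynomial V ℝ) (hp : SosDeg ℓ p) :
    0 ≤ pseudoExp μ p := by
  have := h ∅ p (isSOS_iff_isSumSq.2 hp.1) (by simpa using hp.2)
  simpa [pseudoExp_apply] using this

lemma PDSatisfies.mul_constraint_nonneg (h : PDSatisfies μ ℓ A 0) (i : ι)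
    {p : MvPolynomial V ℝ} {d e : ℕ} (hp : SosDeg d p) (he : (A i).totalDegree ≤ e)
    (hd : d + e ≤ ℓ) :
    0 ≤ pseudoExp μ (p * A i) := by
  have := h {i} p (isSOS_iff_isSumSq.2 hp.1) (by
    rw [Finset.sum_singleton]
    have := hp.2
    omega)
  simpa [pseudoExp_apply] using this

end PseudoExpectation

section Localization

variable {n dx dy mX : ℕ} {y : Fin n → Fin dy → ℝ} {A : Fin n → Matrix (Fin dx) (Fin dy) ℝ}
  {g : Fin mX → MvPolynomial (Fin dx) ℝ} {cbar α Mx : ℝ} {x0 : Fin dx → ℝ} {ℓ : ℕ}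
  {μ : (Fin n ⊕ Fin dx → ℝ) →₀ ℝ}

/-- The polynomial `x_k - x0_k` in the variables `(ω, x)`. -/
def devVar (n : ℕ) {dx : ℕ} (x0 : Fin dx → ℝ) (k : Fin dx) : MvPolynomial (Fin n ⊕ Fin dx) ℝ :=
  X (Sum.inr k) - C (x0 k)

lemma devVar_totalDegree_le (k : Fin dx) : (devVar n x0 k).totalDegree ≤ 1 :=
  (totalDegree_sub_C_le _ _).trans (by simp)

/-- The `j`-th coordinate of `A_iᵀ (x - x0)`. -/
def devLin (A : Fin n → Matrix (Fin dx) (Fin dy) ℝ) (x0 : Fin dx → ℝ) (i : Fin n) (j : Fin dy) :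
    MvPolynomial (Fin n ⊕ Fin dx) ℝ :=
  ∑ k, C (A i k j) * devVar n x0 k

lemma devLin_totalDegree_le (i : Fin n) (j : Fin dy) : (devLin A x0 i j).totalDegree ≤ 1 :=
  totalDegree_finsetSum_le fun k _ => (totalDegree_mul _ _).trans (by
    simpa using devVar_totalDegree_le k)

/-- The polynomial `‖A_iᵀ (x - x0)‖²`. -/
def devSq (A : Fin n → Matrix (Fin dx) (Fin dy) ℝ) (x0 : Fin dx → ℝ) (i : Fin n) :
    MvPolynomial (Fin n ⊕ Fin dx) ℝ :=
  ∑ j, devLin A x0 i j ^ 2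

lemma devSq_sosDeg (i : Fin n) : SosDeg 2 (devSq A x0 i) :=
  SosDeg.sum _ _ fun j _ => SosDeg.sq (devLin_totalDegree_le i j)

lemma aeval_devVar_normAPoly (i : Fin n) :
    MvPolynomial.aeval (devVar n x0) (normAPoly A i) = devSq A x0 i := by
  simp [normAPoly, devSq, devLin, MvPolynomial.algebraMap_eq]

lemma aeval_devVar_vnormPoly :
    MvPolynomial.aeval (devVar n x0) (vnormPoly dx) = ∑ k, devVar n x0 k ^ 2 := by
  simp [vnormPoly]

lemma linForm_totalDegree_le (i : Fin n) (j : Fin dy) :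
    (C (y i j) - ∑ k, C (A i k j) * X (Sum.inr k) :
      MvPolynomial (Fin n ⊕ Fin dx) ℝ).totalDegree ≤ 1 := by
  refine (totalDegree_sub _ _).trans (max_le (by simp) ?_)
  exact totalDegree_finsetSum_le fun k _ => (totalDegree_mul _ _).trans (by simp)

lemma enorm_le_iff {d : ℕ} (v : Fin d → ℝ) {c : ℝ} (hc : 0 ≤ c) :
    _root_.enorm v ≤ c ↔ ∑ k, v k ^ 2 ≤ c ^ 2 :=
  Real.sqrt_le_left hc

/-- At an inlier, a pseudo-distribution satisfying the system localizes `x` near `x0` along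
`A_i`. -/
lemma PDSatisfies.localExpect (hsat : PDSatisfies μ ℓ (sysT y A g cbar α) 0) (hcbar : 0 < cbar)
    (i : Fin n) (hin : _root_.enorm (fun j => y i j - ∑ k, A i k j * x0 k) ≤ cbar) :
    LocalExpect ℓ (pseudoExp μ) (X (Sum.inl i)) (devSq A x0 i) (2 * cbar) := by
  rw [enorm_le_iff _ hcbar.le] at hin
  set w : MvPolynomial (Fin n ⊕ Fin dx) ℝ := X (Sum.inl i) with hw
  have w1 : w.totalDegree ≤ 1 := by simp [hw]
  have w2 : (w ^ 2).totalDegree ≤ 2 := (totalDegree_pow _ _).trans (by omega)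
  have hsq : ∀ h d, SosDeg d h → d + 2 ≤ ℓ →
      pseudoExp μ (h * w ^ 2) = pseudoExp μ (h * w) := by
    intro h d hh hd
    have h1 := hsat.mul_constraint_nonneg (Sum.inr (Sum.inl i)) hh (e := 2)
      ((totalDegree_sub _ _).trans (max_le (w1.trans (by norm_num)) w2)) hd
    have h2 := hsat.mul_constraint_nonneg (Sum.inr (Sum.inr (Sum.inl i))) hh (e := 2)
      ((totalDegree_sub _ _).trans (max_le w2 (w1.trans (by norm_num)))) hd
    simp only [sysT, sysM, mul_sub, map_sub] at h1 h2
    rw [← hw] at h1 h2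
    linarith
  refine ⟨w1, hsat.sos_nonneg, hsq, fun h d hh hd => ?_⟩
  set β : Fin dy → ℝ := fun j => y i j - ∑ k, A i k j * x0 k
  set ρ : Fin dy → MvPolynomial (Fin n ⊕ Fin dx) ℝ :=
    fun j => C (y i j) - ∑ k, C (A i k j) * X (Sum.inr k)
  have hρ : ∀ j, (ρ j).totalDegree ≤ 1 := fun j => linForm_totalDegree_le i j
  have hresid : residPoly y A i = ∑ j, ρ j ^ 2 := rfl
  have hdev : ∀ j, devLin A x0 i j = C (β j) - ρ j := by
    intro j
    simp only [devLin, devVar, β, ρ, map_sub, map_sum, map_mul, mul_sub, Finset.sum_sub_distrib]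
    ring
  set u : MvPolynomial (Fin n ⊕ Fin dx) ℝ := ∑ j, (ρ j + C (β j)) ^ 2
  have hu : SosDeg 2 u := SosDeg.sum _ _ fun j _ =>
    SosDeg.sq ((totalDegree_add _ _).trans (max_le (hρ j) (by simp)))
  set b : ℝ := ∑ j, β j ^ 2
  have hs : devSq A x0 i = 2 * residPoly y A i + 2 * C b - u := by
    simp only [devSq, hresid, u, b, map_sum, Finset.mul_sum, ← Finset.sum_add_distrib,
      ← Finset.sum_sub_distrib]
    refine Finset.sum_congr rfl fun j _ => ?_
    rw [hdev, C_pow]; ring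
  have hb : 0 ≤ b := Finset.sum_nonneg fun j _ => sq_nonneg _
  have i1 := hsat.mul_constraint_nonneg (Sum.inr (Sum.inr (Sum.inr (Sum.inl i)))) hh (e := 3) (by
    refine (totalDegree_sub _ _).trans (max_le ((totalDegree_C _).le.trans (by omega)) ?_)
    refine (totalDegree_mul _ _).trans ?_
    have : (residPoly y A i).totalDegree ≤ 2 :=
      totalDegree_finsetSum_le fun j _ => (totalDegree_pow _ _).trans (by
        have := hρ j
        simp only [ρ] at this
        omega)
    simp only [totalDegree_X]
    omega) (by omega)
  simp only [sysT, sysM] at i1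
  rw [← hw] at i1
  have i2 : 0 ≤ pseudoExp μ (h * u * w) := by
    rw [← hsq _ _ (hh.mul hu) (by omega)]
    exact hsat.sos_nonneg _ (((hh.mul hu).mul (SosDeg.sq w1)).mono (by omega))
  have i3 : 0 ≤ pseudoExp μ (h * (1 - w)) := by
    have h1 : (1 - w).totalDegree ≤ 1 := (totalDegree_sub _ _).trans (max_le (by simp) w1)
    have h2 := hsat.sos_nonneg _ ((hh.mul (SosDeg.sq h1)).mono (by omega))
    have e : h * (1 - w) ^ 2 = h * (1 - w) - h * w + h * w ^ 2 := by ring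
    rw [e, map_add, map_sub, hsq h d hh (by omega)] at h2
    linarith
  have i4 : 0 ≤ pseudoExp μ h := hsat.sos_nonneg _ (hh.mono (by omega))
  have e : h * (C ((2 * cbar) ^ 2) - w * devSq A x0 i)
      = C 2 * (h * (C (cbar ^ 2) - w * residPoly y A i)) + C (2 * (cbar ^ 2 - b)) * h
        + C (2 * b) * (h * (1 - w)) + h * u * w := by
    rw [hs]
    simp only [C_mul, C_pow, C_sub]
    rw [show (C 2 : MvPolynomial (Fin n ⊕ Fin dx) ℝ) = 2 from rfl]
    ring
  rw [e, map_add, map_add, map_add, LocalExpect.map_C_mul, LocalExpect.map_C_mul,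
    LocalExpect.map_C_mul]
  have := mul_nonneg (sub_nonneg.2 hin) i4
  have := mul_nonneg hb i3
  nlinarith

lemma vnormPoly_totalDegree_le : (vnormPoly dx).totalDegree ≤ 2 :=
  totalDegree_finsetSum_le fun k _ => (totalDegree_pow _ _).trans (by simp)

/-- The norm bound on `x - x0`, weighted by a sum of squares. -/
lemma PDSatisfies.mul_ball_nonneg (hsat : PDSatisfies μ ℓ (sysT y A g cbar α) 0) {j0 : Fin mX}
    (hj0 : g j0 = C (Mx ^ 2) - vnormPoly dx) (hx0 : 0 ≤ MvPolynomial.eval x0 (g j0))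
    {h : MvPolynomial (Fin n ⊕ Fin dx) ℝ} {d : ℕ} (hh : SosDeg d h) (hd : d + 2 ≤ ℓ) :
    0 ≤ pseudoExp μ (h * (C ((2 * Mx) ^ 2) - ∑ k, devVar n x0 k ^ 2)) := by
  have i1 := hsat.mul_constraint_nonneg (Sum.inr (Sum.inr (Sum.inr (Sum.inr j0)))) hh (e := 2) (by
    refine (totalDegree_rename_le _ _).trans ?_
    rw [hj0]
    exact (totalDegree_sub _ _).trans
      (max_le ((totalDegree_C _).le.trans (by omega)) vnormPoly_totalDegree_le)) hd
  simp only [sysT, sysM, hj0, vnormPoly, map_sub, map_sum, map_pow, rename_X, rename_C] at i1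
  rw [hj0, map_sub, eval_C, eval_vnormPoly] at hx0
  set u : MvPolynomial (Fin n ⊕ Fin dx) ℝ := ∑ k, (X (Sum.inr k) + C (x0 k)) ^ 2 with hu_def
  have hu : SosDeg 2 u := SosDeg.sum _ _ fun k _ =>
    SosDeg.sq (d := 1) ((totalDegree_add _ _).trans (max_le (by simp) (by simp)))
  have i2 := hsat.sos_nonneg _ ((hh.mul hu).mono hd)
  have i3 := hsat.sos_nonneg _ (hh.mono (by omega))
  have hs : ∑ k, devVar n x0 k ^ 2
      = 2 * ∑ k, (X (Sum.inr k) : MvPolynomial (Fin n ⊕ Fin dx) ℝ) ^ 2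
        + 2 * C (∑ k, x0 k ^ 2) - u := by
    simp only [hu_def, devVar, map_sum, Finset.mul_sum, ← Finset.sum_add_distrib,
      ← Finset.sum_sub_distrib]
    refine Finset.sum_congr rfl fun k _ => ?_
    rw [C_pow]; ring
  have e : h * (C ((2 * Mx) ^ 2) - ∑ k, devVar n x0 k ^ 2)
      = C 2 * (h * (C Mx ^ 2 - ∑ k, (X (Sum.inr k) : MvPolynomial (Fin n ⊕ Fin dx) ℝ) ^ 2))
        + C (2 * (Mx ^ 2 - ∑ k, x0 k ^ 2)) * h + h * u := by
    rw [hs]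
    simp only [C_mul, C_sub, C_pow]
    rw [show (C 2 : MvPolynomial (Fin n ⊕ Fin dx) ℝ) = 2 from rfl]
    ring
  rw [e, map_add, map_add, LocalExpect.map_C_mul, LocalExpect.map_C_mul]
  have := mul_nonneg hx0 i3
  nlinarith

lemma totalDegree_le_of_mul_ball {P : MvPolynomial (Fin dx) ℝ} {k : ℕ} {M : ℝ} (hdx : 0 < dx)
    (hP : P ≠ 0) (h : (P * (C (M ^ 2) - vnormPoly dx)).totalDegree ≤ k) :
    P.totalDegree + 2 ≤ k := by
  set u : Fin dx → ℝ := Pi.single ⟨0, hdx⟩ 1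
  have h1 := natDegree_lineRestrict_le u (C (M ^ 2) - vnormPoly dx)
  have hn : ∑ k, u k ^ 2 = 1 := by
    rw [Finset.sum_eq_single ⟨0, hdx⟩]
    · simp [u]
    · intro b _ hb
      simp [u, Pi.single_eq_of_ne hb]
    · simp
  have h2 : (lineRestrict u (C (M ^ 2) - vnormPoly dx)).natDegree = 2 := by
    rw [map_sub, lineRestrict_C, lineRestrict_vnormPoly, hn, Polynomial.C_1, one_mul]
    compute_degree!
  have h3 : C (M ^ 2) - vnormPoly dx ≠ 0 := by
    intro h0
    rw [h0] at h2
    simp at h2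
  rw [totalDegree_mul_of_isDomain hP h3] at h
  omega

/-- The averaged anti-concentration inequality holds in pseudo-expectation. -/
lemma PDSatisfies.sum_anticonc_le (hsat : PDSatisfies μ ℓ (sysT y A g cbar α) 0)
    (hpd : IsPseudoDist μ ℓ) {j0 : Fin mX}
    (hj0 : g j0 = C (Mx ^ 2) - vnormPoly dx) (hx0 : 0 ≤ MvPolynomial.eval x0 (g j0))
    (hdx : 0 < dx) {I : Finset (Fin n)} (hI : I.Nonempty) {q : Polynomial ℝ} {K : ℝ} {k : ℕ}
    (hk : k ≤ ℓ)
    (h : SosProof (fun _ : Fin 1 => C ((2 * Mx) ^ 2) - vnormPoly dx) k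
      (C K - anticoncPoly A I q)) :
    ∑ i ∈ I, ∑ k, pseudoExp μ (devVar n x0 k ^ 2 * Polynomial.aeval (devSq A x0 i) q ^ 2)
      ≤ I.card * K := by
  obtain ⟨P, hP, hPe, hPd⟩ := h
  have hterm : ∀ S : Finset (Fin 1), 0 ≤ pseudoExp μ (MvPolynomial.aeval (devVar n x0)
      (P S * ∏ i ∈ S, (C ((2 * Mx) ^ 2) - vnormPoly dx))) := by
    intro S
    have hd := hPd S
    have hs := isSOS_iff_isSumSq.1 (hP S)
    rw [Finset.prod_const] at hd ⊢
    have hcard : S.card ≤ 1 := by simpa using Finset.card_le_univ S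
    interval_cases S.card
    · rw [pow_zero, mul_one] at hd ⊢
      exact hsat.sos_nonneg _ (SosDeg.aeval devVar_totalDegree_le ⟨hs, hd.trans hk⟩)
    · rw [pow_one] at hd ⊢
      by_cases hP0 : P S = 0
      · simp [hP0]
      have hd2 := totalDegree_le_of_mul_ball hdx hP0 hd
      rw [map_mul, map_sub, aeval_devVar_vnormPoly, MvPolynomial.algHom_C]
      exact hsat.mul_ball_nonneg hj0 hx0 (SosDeg.aeval devVar_totalDegree_le ⟨hs, le_rfl⟩)
        (by omega)
  have h1 : 0 ≤ pseudoExp μ (MvPolynomial.aeval (devVar n x0) (C K - anticoncPoly A I q)) := by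
    rw [hPe, map_sum, map_sum]
    exact Finset.sum_nonneg fun S _ => hterm S
  have e : MvPolynomial.aeval (devVar n x0) (C K - anticoncPoly A I q)
      = C K - C ((I.card : ℝ)⁻¹) * ∑ i ∈ I, ∑ k,
        devVar n x0 k ^ 2 * Polynomial.aeval (devSq A x0 i) q ^ 2 := by
    rw [map_sub, anticoncPoly, map_mul, map_mul, aeval_devVar_vnormPoly, MvPolynomial.algHom_C,
      MvPolynomial.algHom_C, map_sum, MvPolynomial.algebraMap_eq]
    simp only [map_pow, ← Polynomial.aeval_algHom_apply, aeval_devVar_normAPoly,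
      ← Finset.sum_mul, ← Finset.mul_sum]
    ring
  rw [e, map_sub, LocalExpect.map_C_mul, pseudoExp_C hpd] at h1
  simp only [map_sum] at h1
  have hc : (0 : ℝ) < I.card := by exact_mod_cast hI.card_pos
  have h2 := mul_nonneg hc.le h1
  rw [mul_sub, ← mul_assoc, mul_inv_cancel₀ hc.ne', one_mul] at h2
  linarith

end Localization


section MinimalNorm

variable {V : Type*}

lemma pExpect_smul_add_single (μ : (V → ℝ) →₀ ℝ) (z0 : V → ℝ) (a b : ℝ) (f : (V → ℝ) → ℝ) :
    pExpect (a • μ + Finsupp.single z0 b) f = a * pExpect μ f + b * f z0 := by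
  have h : ∀ ν : (V → ℝ) →₀ ℝ, pExpect ν f = ν.sum fun z c => c * f z := fun _ => rfl
  rw [h, h, Finsupp.sum_add_index' (by simp) (fun z b c => add_mul b c (f z)),
    Finsupp.sum_smul_index (by simp), Finsupp.sum_single_index (by simp), Finsupp.mul_sum]
  simp only [mul_assoc]

lemma IsPseudoDist.mix {μ : (V → ℝ) →₀ ℝ} {ℓ : ℕ} (h : IsPseudoDist μ ℓ) (z0 : V → ℝ) {t : ℝ}
    (ht : t ∈ Set.Icc (0 : ℝ) 1) : IsPseudoDist ((1 - t) • μ + Finsupp.single z0 t) ℓ := by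
  constructor
  · have h1 : ∀ ν : (V → ℝ) →₀ ℝ, ∑ z ∈ ν.support, ν z = pExpect ν fun _ => 1 := by
      simp [pExpect]
    rw [h1, pExpect_smul_add_single, ← h1, h.1]
    ring
  · intro p hp
    rw [pExpect_smul_add_single]
    exact add_nonneg (mul_nonneg (sub_nonneg.2 ht.2) (h.2 p hp)) (mul_nonneg ht.1 (sq_nonneg _))

lemma PDSatisfies.mix {ι : Type*} [Fintype ι] [DecidableEq ι] {μ : (V → ℝ) →₀ ℝ} {ℓ k : ℕ}
    {A : ι → MvPolynomial V ℝ} (h : PDSatisfies μ ℓ A k) {z0 : V → ℝ}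
    (hz : ∀ i, 0 ≤ MvPolynomial.eval z0 (A i)) {t : ℝ} (ht : t ∈ Set.Icc (0 : ℝ) 1) :
    PDSatisfies ((1 - t) • μ + Finsupp.single z0 t) ℓ A k := by
  intro S p hp hd
  rw [pExpect_smul_add_single]
  refine add_nonneg (mul_nonneg (sub_nonneg.2 ht.2) (h S p hp hd)) (mul_nonneg ht.1 ?_)
  rw [map_mul, map_prod]
  exact mul_nonneg (hp.eval_nonneg z0) (Finset.prod_nonneg fun i _ => hz i)

variable {n dx dy mX : ℕ} {y : Fin n → Fin dy → ℝ} {A : Fin n → Matrix (Fin dx) (Fin dy) ℝ}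
  {g : Fin mX → MvPolynomial (Fin dx) ℝ} {cbar α : ℝ} {x0 : Fin dx → ℝ} {ℓ : ℕ}
  {μ : (Fin n ⊕ Fin dx → ℝ) →₀ ℝ} {I : Finset (Fin n)}

/-- The indicator of the inlier set together with the ground truth satisfies the system. -/
lemma eval_sysT_nonneg (hx0 : ∀ j, 0 ≤ MvPolynomial.eval x0 (g j)) (hcbar : 0 < cbar)
    (hIcard : (I.card : ℝ) = α * n)
    (hinlier : ∀ i ∈ I, _root_.enorm (fun j => y i j - ∑ k, A i k j * x0 k) ≤ cbar)
    (e : Fin 2 ⊕ (Fin n ⊕ Fin n ⊕ Fin n ⊕ Fin mX)) :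
    0 ≤ MvPolynomial.eval (Sum.elim (fun i => if i ∈ I then 1 else 0) x0)
      (sysT y A g cbar α e) := by
  rcases e with j | i | i | i | j
  · by_cases hj : j = 0 <;> simp [sysT, hj, hIcard]
  · by_cases hi : i ∈ I <;> simp [sysT, sysM, hi]
  · by_cases hi : i ∈ I <;> simp [sysT, sysM, hi]
  · by_cases hi : i ∈ I
    · have := (enorm_le_iff _ hcbar.le).1 (hinlier i hi)
      simpa [sysT, sysM, residPoly, hi] using this
    · simpa [sysT, sysM, hi] using sq_nonneg cbar
  · simpa [sysT, sysM, eval_rename, Function.comp_def] using hx0 j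

lemma Eω_eq_pseudoExp (i : Fin n) : Eω μ i = pseudoExp μ (X (Sum.inl i)) := by
  simp [Eω, pseudoExp_apply]

lemma PDSatisfies.Eω_nonneg (hsat : PDSatisfies μ ℓ (sysT y A g cbar α) 0) (hℓ : 2 ≤ ℓ)
    (i : Fin n) : 0 ≤ Eω μ i := by
  have h1 := hsat.sos_nonneg (X (Sum.inl i) ^ 2) ((SosDeg.sq (d := 1) (by simp)).mono hℓ)
  have h2 := hsat.mul_constraint_nonneg (Sum.inr (Sum.inl i)) (p := 1) (d := 0) (e := 2)
    (by simpa using SosDeg.const (V := Fin n ⊕ Fin dx) (d := 0) zero_le_one)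
    ((totalDegree_sub _ _).trans (max_le (by simp) ((totalDegree_pow _ _).trans (by simp))))
    (by omega)
  simp only [sysT, sysM, one_mul, map_sub] at h2
  rw [Eω_eq_pseudoExp]
  linarith

lemma PDSatisfies.sum_Eω (hsat : PDSatisfies μ ℓ (sysT y A g cbar α) 0)
    (hpd : IsPseudoDist μ ℓ) (hℓ : 1 ≤ ℓ) : ∑ i, Eω μ i = α * n := by
  have hone : SosDeg 0 (1 : MvPolynomial (Fin n ⊕ Fin dx) ℝ) := by
    simpa using SosDeg.const (V := Fin n ⊕ Fin dx) (d := 0) zero_le_one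
  have hdeg : (∑ i, (X (Sum.inl i) : MvPolynomial (Fin n ⊕ Fin dx) ℝ)).totalDegree ≤ 1 :=
    totalDegree_finsetSum_le fun i _ => by simp
  have h1 := hsat.mul_constraint_nonneg (Sum.inl 0) hone (e := 1) (by
    simp only [sysT, if_true]
    exact (totalDegree_sub _ _).trans (max_le ((totalDegree_C _).le.trans zero_le_one) hdeg))
    (by omega)
  have h2 := hsat.mul_constraint_nonneg (Sum.inl 1) hone (e := 1) (by
    simp only [sysT, one_ne_zero, if_false]
    exact (totalDegree_sub _ _).trans (max_le hdeg ((totalDegree_C _).le.trans zero_le_one)))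
    (by omega)
  simp only [sysT, if_true, one_ne_zero, if_false, one_mul, map_sub, pseudoExp_C hpd,
    map_sum, ← Eω_eq_pseudoExp] at h1 h2
  linarith

/-- If the segment from `w` to `u` does not decrease the norm at `w`, then `‖w‖² ≤ ⟪w, u⟫`. -/
lemma sum_sq_le_sum_mul_of_minimal {ι : Type*} [Fintype ι] (w u : ι → ℝ)
    (h : ∀ t ∈ Set.Icc (0 : ℝ) 1, ∑ i, w i ^ 2 ≤ ∑ i, ((1 - t) * w i + t * u i) ^ 2) :
    ∑ i, w i ^ 2 ≤ ∑ i, w i * u i := by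
  set W := ∑ i, w i ^ 2
  set P := ∑ i, w i * u i
  set D := ∑ i, (u i - w i) ^ 2
  have hD : 0 ≤ D := Finset.sum_nonneg fun i _ => sq_nonneg _
  have key : ∀ t ∈ Set.Icc (0 : ℝ) 1, 0 ≤ 2 * t * (P - W) + t ^ 2 * D := by
    intro t ht
    have e : ∑ i, ((1 - t) * w i + t * u i) ^ 2 = W + (2 * t * (P - W) + t ^ 2 * D) := by
      simp only [W, P, D, Finset.mul_sum, ← Finset.sum_add_distrib, ← Finset.sum_sub_distrib]
      exact Finset.sum_congr rfl fun i _ => by ring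
    have := h t ht
    linarith
  by_contra! hlt
  set t := (W - P) / (W - P + D)
  have hpos : 0 < W - P + D := by linarith
  have ht0 : 0 < t := div_pos (by linarith) hpos
  have ht1 : t ≤ 1 := (div_le_one hpos).2 (by linarith)
  have htD : t * (W - P + D) = W - P := div_mul_cancel₀ _ hpos.ne'
  have := key t ⟨ht0.le, ht1⟩
  nlinarith [mul_pos ht0 ht0, mul_pos ht0 (sub_pos.2 hlt),
    mul_pos (mul_pos ht0 ht0) (sub_pos.2 hlt)]

/-- A pseudo-distribution of minimal norm gives large weight to the inliers. -/
lemma PDSatisfies.le_sum_inliers (hsat : PDSatisfies μ ℓ (sysT y A g cbar α) 0)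
    (hpd : IsPseudoDist μ ℓ) (hℓ : 1 ≤ ℓ) (hn : 0 < n)
    (hx0 : ∀ j, 0 ≤ MvPolynomial.eval x0 (g j)) (hcbar : 0 < cbar)
    (hIcard : (I.card : ℝ) = α * n)
    (hinlier : ∀ i ∈ I, _root_.enorm (fun j => y i j - ∑ k, A i k j * x0 k) ≤ cbar)
    (hmin : ∀ ν : (Fin n ⊕ Fin dx → ℝ) →₀ ℝ, IsPseudoDist ν ℓ →
      PDSatisfies ν ℓ (sysT y A g cbar α) 0 →
      _root_.enorm (fun i => Eω μ i) ≤ _root_.enorm (fun i => Eω ν i)) :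
    α ^ 2 * n ≤ ∑ i ∈ I, Eω μ i := by
  have h1 : ∑ i, Eω μ i ^ 2 ≤ ∑ i, Eω μ i * if i ∈ I then 1 else 0 := by
    refine sum_sq_le_sum_mul_of_minimal _ _ fun t ht => ?_
    have h := hmin _ (hpd.mix _ ht)
      (hsat.mix (eval_sysT_nonneg hx0 hcbar hIcard hinlier) ht)
    rw [_root_.enorm, _root_.enorm,
      Real.sqrt_le_sqrt_iff (Finset.sum_nonneg fun i _ => sq_nonneg _)] at h
    simpa only [Eω, pExpect_smul_add_single, Sum.elim_inl] using h
  have h2 : (α * n) ^ 2 ≤ n * ∑ i, Eω μ i ^ 2 := by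
    rw [← hsat.sum_Eω hpd hℓ]
    simpa using sq_sum_le_card_mul_sum_sq (s := Finset.univ) (f := fun i => Eω μ i)
  have hn' : (0 : ℝ) < n := by exact_mod_cast hn
  have h3 : α ^ 2 * n ≤ ∑ i, Eω μ i ^ 2 := by
    refine le_of_mul_le_mul_left ?_ hn'
    linarith
  simp only [mul_ite, mul_one, mul_zero, Finset.sum_ite_mem, Finset.univ_inter] at h1
  linarith

end MinimalNorm

section Concentration

variable {n dx dy mX : ℕ} {y : Fin n → Fin dy → ℝ} {A : Fin n → Matrix (Fin dx) (Fin dy) ℝ}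
  {g : Fin mX → MvPolynomial (Fin dx) ℝ} {cbar α Mx : ℝ} {x0 : Fin dx → ℝ} {ℓ : ℕ}
  {μ : (Fin n ⊕ Fin dx → ℝ) →₀ ℝ} {I : Finset (Fin n)}

lemma PDSatisfies.sum_devVar_sq_le (hsat : PDSatisfies μ ℓ (sysT y A g cbar α) 0)
    (hpd : IsPseudoDist μ ℓ) (hℓ : 2 ≤ ℓ) {j0 : Fin mX}
    (hj0 : g j0 = C (Mx ^ 2) - vnormPoly dx) (hx0 : 0 ≤ MvPolynomial.eval x0 (g j0)) :
    ∑ k, pseudoExp μ (devVar n x0 k ^ 2) ≤ (2 * Mx) ^ 2 := by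
  have h := hsat.mul_ball_nonneg hj0 hx0 (SosDeg.const (d := 0) zero_le_one) (by omega)
  rw [C_1, one_mul, map_sub, pseudoExp_C hpd, map_sum] at h
  linarith

lemma Polynomial.eq_one_add_C_mul_X_of_natDegree_le_one {q : Polynomial ℝ}
    (hq : q.natDegree ≤ 1) (hq0 : q.eval 0 = 1) :
    q = 1 + Polynomial.C (q.coeff 1) * Polynomial.X := by
  have h0 : q.coeff 0 = 1 := by rw [Polynomial.coeff_zero_eq_eval_zero, hq0]
  conv_lhs => rw [Polynomial.eq_X_add_C_of_natDegree_le_one hq, h0]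
  rw [Polynomial.C_1, add_comm]

/-- The estimate for all polynomials `q` other than decreasing affine ones. -/
lemma LocalExpect.sq_le_aeval {V : Type*} {E : MvPolynomial V ℝ →ₗ[ℝ] ℝ} {w s : MvPolynomial V ℝ}
    {δ : ℝ} (H : LocalExpect ℓ E w s δ) (hs : SosDeg 2 s) (hδ : 0 < δ) {q : Polynomial ℝ}
    (hq0 : q.eval 0 = 1) (hqℓ : 4 * q.natDegree + 2 ≤ ℓ) {c : ℝ} (hc : 0 < c)
    (hq : ∀ t ∈ Set.Icc 0 (δ ^ 2), c ≤ q.eval t) (hcoeff : q.natDegree ≤ 1 → 0 ≤ q.coeff 1)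
    {L : MvPolynomial V ℝ} (hL : L.totalDegree ≤ 1) :
    c ^ 2 * E (L * w) ^ 2 ≤ E w * E (L ^ 2 * Polynomial.aeval s q ^ 2) := by
  by_cases hm : 2 ≤ q.natDegree
  · exact H.sq_le_of_two_le_natDegree hs hδ hL hm hqℓ hc hq
  have hm1 : q.natDegree ≤ 1 := by omega
  have hc1 : c ≤ 1 := hq0 ▸ hq 0 ⟨le_rfl, sq_nonneg δ⟩
  have hcs : c ^ 2 * E (L * w) ^ 2 ≤ E (L * w) ^ 2 :=
    mul_le_of_le_one_left (sq_nonneg _) (pow_le_one₀ hc.le hc1)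
  refine hcs.trans ?_
  have hqe := Polynomial.eq_one_add_C_mul_X_of_natDegree_le_one hm1 hq0
  have ha := hcoeff hm1
  have e : Polynomial.aeval s q = 1 + C (q.coeff 1) * s := by
    conv_lhs => rw [hqe]
    simp [MvPolynomial.algebraMap_eq]
  rw [e]
  by_cases hd : q.natDegree = 1
  · exact H.sq_le_of_affine_nonneg hs hL (by omega) ha
  · rw [Polynomial.coeff_eq_zero_of_natDegree_lt (by omega)]
    simpa using H.sq_le hL (by omega) (by omega)

/-- The pseudo-covariances of `ω_i` with `x - x0` are small on average over the inliers. -/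
lemma PDSatisfies.exists_covariance_bound (hsat : PDSatisfies μ ℓ (sysT y A g cbar α) 0)
    (hpd : IsPseudoDist μ ℓ) (hdx : 0 < dx) (hMx : 0 < Mx) {j0 : Fin mX}
    (hj0 : g j0 = C (Mx ^ 2) - vnormPoly dx) (hx0 : 0 ≤ MvPolynomial.eval x0 (g j0))
    (hcbar : 0 < cbar) (hI : I.Nonempty)
    (hinlier : ∀ i ∈ I, _root_.enorm (fun j => y i j - ∑ k, A i k j * x0 k) ≤ cbar)
    {η : ℝ} {k : ℕ} (hk : 2 ≤ k) (hkℓ : k ≤ ℓ)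
    (hAC : AntiConcentrated A I k
      (α ^ 2 * η ^ 2 * (1 - 2 * cbar) ^ 2 / (32 * cbar)) (2 * cbar) (2 * Mx)) :
    ∃ B : Fin n → ℝ, (∀ i ∈ I, 0 ≤ B i) ∧
      (∀ i ∈ I, ∑ k, pseudoExp μ (devVar n x0 k * X (Sum.inl i)) ^ 2 ≤ Eω μ i * B i) ∧
      ∑ i ∈ I, B i ≤ I.card * (α ^ 2 * η ^ 2 * Mx ^ 2 / 2) := by
  obtain ⟨q, hq0, hq, hqk, hsos⟩ := hAC.exists_bounded hI hk
  have hK : α ^ 2 * η ^ 2 * (1 - 2 * cbar) ^ 2 / (32 * cbar) * (2 * cbar) * (2 * Mx) ^ 2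
      = α ^ 2 * η ^ 2 * (1 - 2 * cbar) ^ 2 * Mx ^ 2 / 4 := by
    field_simp
    ring
  rw [hK] at hsos
  have hKpos := SosProof.anticonc_pos hdx (by linarith) hq0 hsos hI
  have hne : 1 - 2 * cbar ≠ 0 := by
    intro h0
    simp [h0] at hKpos
  set c := |1 - 2 * cbar| with hc_def
  have hc : 0 < c := abs_pos.2 hne
  have hc2 : (1 - 2 * cbar) ^ 2 = c ^ 2 := (sq_abs _).symm
  rw [hc2] at hsos hKpos
  have hqc : ∀ t ∈ Set.Icc 0 ((2 * cbar) ^ 2), c ≤ q.eval t := abs_le_eval_of_sq_le hq0 hne hq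
  have hδ : 0 < 2 * cbar := by linarith
  have hcard : (0 : ℝ) < I.card := by exact_mod_cast hI.card_pos
  have hG := hsat.sum_anticonc_le hpd hj0 hx0 hdx hI hkℓ hsos
  set G : Fin n → ℝ := fun i =>
    ∑ k, pseudoExp μ (devVar n x0 k ^ 2 * Polynomial.aeval (devSq A x0 i) q ^ 2) with hG_def
  have hG0 : ∀ i, 0 ≤ G i := fun i => Finset.sum_nonneg fun k _ =>
    hsat.sos_nonneg _ (((SosDeg.sq (devVar_totalDegree_le k)).mul
      (SosDeg.sq (totalDegree_polynomial_aeval_le (devSq_sosDeg i).2 q))).mono (by omega))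
  have hH := fun i hi => hsat.localExpect hcbar i (hinlier i hi)
  by_cases hcoeff : q.natDegree ≤ 1 → 0 ≤ q.coeff 1
  · refine ⟨fun i => G i / c ^ 2, fun i _ => div_nonneg (hG0 i) (sq_nonneg _), fun i hi => ?_, ?_⟩
    · rw [mul_div_assoc', le_div_iff₀' (pow_pos hc 2), hG_def, Finset.mul_sum, Finset.mul_sum,
        Eω_eq_pseudoExp]
      exact Finset.sum_le_sum fun k _ => (hH i hi).sq_le_aeval (devSq_sosDeg i) hδ hq0
        (hqk.trans hkℓ) hc hqc hcoeff (devVar_totalDegree_le k)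
    · rw [← Finset.sum_div, div_le_iff₀ (pow_pos hc 2)]
      refine hG.trans ?_
      have : 0 ≤ I.card * (α ^ 2 * η ^ 2 * c ^ 2 * Mx ^ 2) := by positivity
      linarith
  push Not at hcoeff
  obtain ⟨hm, ha⟩ := hcoeff
  set β := -q.coeff 1 with hβ_def
  have hβ : 0 ≤ β := by linarith
  have hqe : q = 1 + Polynomial.C (-β) * Polynomial.X := by
    rw [hβ_def, neg_neg]
    exact Polynomial.eq_one_add_C_mul_X_of_natDegree_le_one hm hq0
  have hqev : ∀ t, q.eval t = 1 + -β * t := fun t => by rw [hqe]; simp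
  have hqa : ∀ i, Polynomial.aeval (devSq A x0 i) q = 1 - C β * devSq A x0 i := fun i => by
    rw [hqe]; simp [MvPolynomial.algebraMap_eq, sub_eq_add_neg]
  have hd1 : q.natDegree = 1 := by
    refine le_antisymm hm (Nat.one_le_iff_ne_zero.2 fun h0 => ?_)
    rw [Polynomial.coeff_eq_zero_of_natDegree_lt (by omega)] at ha
    exact lt_irrefl _ ha
  have hτ : β * (2 * cbar) ^ 2 ≤ 1 - c := by
    have := hqc _ ⟨sq_nonneg (2 * cbar), le_rfl⟩
    rw [hqev] at this
    linarith
  have hc1 : c ≤ 1 := by nlinarith [mul_nonneg hβ (sq_nonneg (2 * cbar))]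
  have hball := hsat.sum_devVar_sq_le hpd (by omega) hj0 hx0
  have hMK := SosProof.anticonc_affine hdx hqev hsos hI
  refine ⟨fun i => 2 * (1 - c) ^ 2 * (2 * Mx) ^ 2 + 2 * G i,
    fun i _ => by have := hG0 i; positivity, fun i hi => ?_, ?_⟩
  · have hW : 0 ≤ Eω μ i := hsat.Eω_nonneg (by omega) i
    calc ∑ k, pseudoExp μ (devVar n x0 k * X (Sum.inl i)) ^ 2
        ≤ ∑ k, Eω μ i * (2 * (1 - c) ^ 2 * pseudoExp μ (devVar n x0 k ^ 2) + 2 * pseudoExp μ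
            (devVar n x0 k ^ 2 * Polynomial.aeval (devSq A x0 i) q ^ 2)) := by
          refine Finset.sum_le_sum fun k _ => ?_
          rw [hqa, Eω_eq_pseudoExp]
          exact (hH i hi).sq_le_of_affine_nonpos (J := Finset.univ)
            (fun j _ => devLin_totalDegree_le i j) rfl (devVar_totalDegree_le k) (by omega) hβ hτ
      _ = Eω μ i * (2 * (1 - c) ^ 2 * ∑ k, pseudoExp μ (devVar n x0 k ^ 2) + 2 * G i) := by
          rw [← Finset.mul_sum, Finset.sum_add_distrib, ← Finset.mul_sum, ← Finset.mul_sum]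
      _ ≤ Eω μ i * (2 * (1 - c) ^ 2 * (2 * Mx) ^ 2 + 2 * G i) := by gcongr
  · rw [Finset.sum_add_distrib, Finset.sum_const, nsmul_eq_mul, ← Finset.mul_sum]
    have hpoly : c ^ 2 * (1 + 9 * (1 - c) ^ 2) ≤ 1 := by
      have h1 : 0 ≤ 1 - c := by linarith
      nlinarith [mul_nonneg h1 hc.le, mul_nonneg (mul_nonneg h1 hc.le) (sq_nonneg (3 * c - 2)),
        mul_nonneg h1 (sq_nonneg (3 * c - 2))]
    set Q := α ^ 2 * η ^ 2 * Mx ^ 2 with hQ_def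
    have hQ : 0 ≤ Q := by positivity
    have e : α ^ 2 * η ^ 2 * c ^ 2 * Mx ^ 2 / 4 = c ^ 2 * Q / 4 := by rw [hQ_def]; ring
    rw [e] at hMK hG
    have h1 : 2 * (1 - c) ^ 2 * (2 * Mx) ^ 2 ≤ 2 * (1 - c) ^ 2 * (9 * (c ^ 2 * Q / 4)) := by
      gcongr
    have h2 : 2 * (1 - c) ^ 2 * (9 * (c ^ 2 * Q / 4)) + c ^ 2 * Q / 2 ≤ Q / 2 := by
      nlinarith [mul_le_mul_of_nonneg_right hpoly hQ]
    calc I.card * (2 * (1 - c) ^ 2 * (2 * Mx) ^ 2) + 2 * ∑ i ∈ I, G i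
        ≤ I.card * (Q / 2 - c ^ 2 * Q / 2) + 2 * (I.card * (c ^ 2 * Q / 4)) := by
          exact add_le_add (mul_le_mul_of_nonneg_left (by linarith) hcard.le) (by linarith)
      _ = I.card * (Q / 2) := by ring

lemma pseudoExp_devVar_mul (k : Fin dx) (i : Fin n) (h : 0 < Eω μ i) :
    pseudoExp μ (devVar n x0 k * X (Sum.inl i)) = Eω μ i * (vEst μ i k - x0 k) := by
  have e : devVar n x0 k * X (Sum.inl i)
      = X (Sum.inl i) * X (Sum.inr k) - C (x0 k) * X (Sum.inl i) := by
    rw [devVar]; ring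
  have e2 : pseudoExp μ (X (Sum.inl i) * X (Sum.inr k))
      = pExpect μ fun z => z (Sum.inl i) * z (Sum.inr k) := by
    simp [pseudoExp_apply]
  rw [e, map_sub, LocalExpect.map_C_mul, e2, ← Eω_eq_pseudoExp, vEst, if_pos h, mul_sub,
    mul_inv_cancel_left₀ h.ne', mul_comm (x0 k)]

/-- The inliers whose estimate is far from the truth carry little weight. -/
lemma Eω_mul_le_of_far {i : Fin n} {B r : ℝ} (hr : 0 ≤ r) (hB0 : 0 ≤ B) (hw : 0 ≤ Eω μ i)
    (hB : ∑ k, pseudoExp μ (devVar n x0 k * X (Sum.inl i)) ^ 2 ≤ Eω μ i * B)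
    (hfar : ¬ _root_.enorm (vEst μ i - x0) ≤ r) : Eω μ i * r ^ 2 ≤ B := by
  rcases hw.eq_or_lt with h0 | h0
  · rwa [← h0, zero_mul]
  rw [enorm_le_iff _ hr, not_le] at hfar
  have e : ∑ k, pseudoExp μ (devVar n x0 k * X (Sum.inl i)) ^ 2
      = Eω μ i * (Eω μ i * ∑ k, (vEst μ i - x0) k ^ 2) := by
    rw [← mul_assoc, Finset.mul_sum]
    refine Finset.sum_congr rfl fun k _ => ?_
    rw [pseudoExp_devVar_mul k i h0, Pi.sub_apply]
    ring
  rw [e] at hB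
  exact (mul_le_mul_of_nonneg_left hfar.le hw).trans (le_of_mul_le_mul_left hB h0)

end Concentration

/-- List-decodable estimation contract: under certifiable anti-concentration of
the inliers, a level-`ℓ` pseudo-distribution (`ℓ ≥ k`) satisfying `T_{ω,x}` at
degree `0` and minimizing `‖Ẽ[ω]‖` puts weight at least `α²·n/2` on the set of
indices whose estimate `v_i` is within `η·M_x` of the ground truth. -/
theorem list_decodable_contract
    {n dx dy mX : ℕ} (hn : 0 < n) (hdx : 0 < dx) (hdy : 0 < dy)
    (y : Fin n → Fin dy → ℝ) (A : Fin n → Matrix (Fin dx) (Fin dy) ℝ)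
    (g : Fin mX → MvPolynomial (Fin dx) ℝ)
    (Mx : ℝ) (hMx : 0 < Mx)
    (j0 : Fin mX) (hj0 : g j0 = C (Mx ^ 2) - vnormPoly dx)
    (x0 : Fin dx → ℝ) (hx0 : ∀ j, 0 ≤ MvPolynomial.eval x0 (g j))
    (cbar : ℝ) (hcbar : 0 < cbar)
    (α : ℝ) (hα0 : 0 < α) (hα1 : α ≤ 1)
    (I : Finset (Fin n)) (hIcard : (I.card : ℝ) = α * n)
    (hinlier : ∀ i ∈ I, _root_.enorm (fun j => y i j - ∑ k, A i k j * x0 k) ≤ cbar)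
    (η : ℝ) (hη : 0 < η)
    (k : ℕ) (hk : 0 < k) (hke : Even k)
    (hAC : AntiConcentrated A I k
      (α ^ 2 * η ^ 2 * (1 - 2 * cbar) ^ 2 / (32 * cbar)) (2 * cbar) (2 * Mx))
    (ℓ : ℕ) (hℓ : k ≤ ℓ)
    (μ : (Fin n ⊕ Fin dx → ℝ) →₀ ℝ)
    (hpd : IsPseudoDist μ ℓ)
    (hsat : PDSatisfies μ ℓ (sysT y A g cbar α) 0)
    (hmin : ∀ ν : (Fin n ⊕ Fin dx → ℝ) →₀ ℝ, IsPseudoDist ν ℓ →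
      PDSatisfies ν ℓ (sysT y A g cbar α) 0 →
      _root_.enorm (fun i => Eω μ i) ≤ _root_.enorm (fun i => Eω ν i)) :
    α ^ 2 * n / 2 ≤
      ∑ i ∈ Finset.univ.filter (fun i => _root_.enorm (vEst μ i - x0) ≤ η * Mx), Eω μ i := by
  have hn' : (0 : ℝ) < n := by exact_mod_cast hn
  have hI : I.Nonempty := by
    rw [← Finset.card_pos]
    have : (0 : ℝ) < I.card := hIcard ▸ mul_pos hα0 hn'
    exact_mod_cast this
  have hk2 : 2 ≤ k := by
    obtain ⟨m, hm⟩ := hke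
    omega
  have hw := hsat.Eω_nonneg (hk2.trans hℓ)
  have hin := hsat.le_sum_inliers hpd (by omega) hn hx0 hcbar hIcard hinlier hmin
  obtain ⟨B, hB0, hB, hBsum⟩ := hsat.exists_covariance_bound hpd hdx hMx hj0 (hx0 j0) hcbar hI
    hinlier hk2 hℓ hAC
  set near : Fin n → Prop := fun i => _root_.enorm (vEst μ i - x0) ≤ η * Mx
  have hr : 0 < η * Mx := mul_pos hη hMx
  have hfar : ∑ i ∈ I with ¬ near i, Eω μ i ≤ α ^ 2 * n / 2 := by
    have h1 : (∑ i ∈ I with ¬ near i, Eω μ i) * (η * Mx) ^ 2 ≤ ∑ i ∈ I, B i := by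
      rw [Finset.sum_mul]
      refine (Finset.sum_le_sum fun i hi => ?_).trans
        (Finset.sum_le_sum_of_subset_of_nonneg (Finset.filter_subset _ _) fun i hi _ => hB0 i hi)
      obtain ⟨hi, hfi⟩ := Finset.mem_filter.1 hi
      exact Eω_mul_le_of_far hr.le (hB0 i hi) (hw i) (hB i hi) hfi
    rw [hIcard] at hBsum
    have h2 : α * n * (α ^ 2 * η ^ 2 * Mx ^ 2 / 2) ≤ α ^ 2 * n / 2 * (η * Mx) ^ 2 := by
      have : 0 ≤ (1 - α) * (α ^ 2 * n / 2 * (η * Mx) ^ 2) :=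
        mul_nonneg (sub_nonneg.2 hα1) (by positivity)
      linarith
    exact le_of_mul_le_mul_right (h1.trans (hBsum.trans h2)) (pow_pos hr 2)
  have hsplit := Finset.sum_filter_add_sum_filter_not I near fun i => Eω μ i
  have hsub : ∑ i ∈ I with near i, Eω μ i ≤ ∑ i ∈ Finset.univ.filter near, Eω μ i :=
    Finset.sum_le_sum_of_subset_of_nonneg
      (Finset.filter_subset_filter _ (Finset.subset_univ I)) fun i _ _ => hw i
  linarith
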